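/- arXiv:2309.13346 — 2 statements merged into one kernel-verified Lean document; each statement's English description precedes it below -/
import Mathlib

section
/- Let F be a field of characteristic 2 and let φ, ψ be anisotropic totally singular quadratic forms over F that are weakly Vishik equivalent. Assume that φ is a special quasi-Pfister neighbor given by a triple (π, b, σ), that cπ ⊆ ψ for some c ∈ F×, and that σ is either a quasi-Pfister form, a quasi-Pfister neighbor of codimension one of some anisotropic quasi-Pfister form over F, or a minimal form over F. Then φ and ψ are similar. -/
/-!
Diagonal quasilinear `p`-forms over a field `F` of characteristic `p`,
following Hoffmann and Zemková. A form of dimension `n` is recorded by its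
coefficient tuple `a : ι → F` (for a finite index type `ι`), the form being
`x ↦ ∑ i, a i * (x i)^p`.
-/

universe u

namespace QLF

open scoped BigOperators

/-- Evaluation of the diagonal quasilinear `p`-form with coefficients `a` at `x`. -/
def eval (p : ℕ) {F : Type*} [CommRing F] {ι : Type*} [Fintype ι]
    (a : ι → F) (x : ι → F) : F :=
  ∑ i, a i * x i ^ p

/-- A form is isotropic if it has a nontrivial zero. -/
def Isotropic (p : ℕ) {F : Type*} [CommRing F] {ι : Type*} [Fintype ι] (a : ι → F) : Prop :=
  ∃ x : ι → F, x ≠ 0 ∧ eval p a x = 0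

/-- A form is anisotropic if it has no nontrivial zero. -/
def Anisotropic (p : ℕ) {F : Type*} [CommRing F] {ι : Type*} [Fintype ι] (a : ι → F) : Prop :=
  ¬ Isotropic p a

/-- In characteristic `p`, the zero set of a diagonal quasilinear `p`-form is a
linear subspace. -/
def zeroSubmodule (p : ℕ) [Fact p.Prime] {F : Type*} [Field F] [CharP F p]
    {ι : Type*} [Fintype ι] (a : ι → F) : Submodule F (ι → F) where
  carrier := {x | eval p a x = 0}
  zero_mem' := by
    have hp : p ≠ 0 := (Fact.out : p.Prime).ne_zero
    simp [eval, zero_pow hp]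
  add_mem' := by
    intro x y hx hy
    haveI : ExpChar F p := .prime Fact.out
    have hxy : eval p a (x + y) = eval p a x + eval p a y := by
      simp only [eval, Pi.add_apply]
      rw [← Finset.sum_add_distrib]
      exact Finset.sum_congr rfl fun i _ => by rw [add_pow_char, mul_add]
    simp only [Set.mem_setOf_eq] at *
    rw [hxy, hx, hy, add_zero]
  smul_mem' := by
    intro c x hx
    simp only [Set.mem_setOf_eq] at *
    have hcx : eval p a (c • x) = c ^ p * eval p a x := by
      simp only [eval, Pi.smul_apply, smul_eq_mul, Finset.mul_sum]
      exact Finset.sum_congr rfl fun i _ => by rw [mul_pow]; ring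
    rw [hcx, hx, mul_zero]

/-- The defect `i₀` of a form: the dimension of its zero set. -/
noncomputable def defect (p : ℕ) [Fact p.Prime] {F : Type*} [Field F] [CharP F p]
    {ι : Type*} [Fintype ι] (a : ι → F) : ℕ :=
  Module.finrank F (zeroSubmodule p a)

/-- Isometry of forms: a linear bijection carrying one form into the other. -/
def Isometric (p : ℕ) {F : Type*} [Field F] {ι κ : Type*} [Fintype ι] [Fintype κ]
    (a : ι → F) (b : κ → F) : Prop :=
  ∃ T : (ι → F) ≃ₗ[F] (κ → F), ∀ x, eval p a x = eval p b (T x)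

/-- `a` is a subform of `b`. -/
def Subform (p : ℕ) {F : Type*} [Field F] {ι κ : Type*} [Fintype ι] [Fintype κ]
    (a : ι → F) (b : κ → F) : Prop :=
  ∃ T : (ι → F) →ₗ[F] (κ → F), Function.Injective T ∧ ∀ x, eval p a x = eval p b (T x)

/-- Similarity of forms: `a ≃ c·b` for some scalar `c ≠ 0`. -/
def Similar (p : ℕ) {F : Type*} [Field F] {ι κ : Type*} [Fintype ι] [Fintype κ]
    (a : ι → F) (b : κ → F) : Prop :=
  ∃ c : F, c ≠ 0 ∧ Isometric p a (fun i => c * b i)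

/-- Vishik equivalence: same dimension, and equal defects over every field
extension `E/F`. -/
def VishikEquiv (p : ℕ) [Fact p.Prime] {F : Type u} [Field F] [CharP F p]
    {ι κ : Type*} [Fintype ι] [Fintype κ] (a : ι → F) (b : κ → F) : Prop :=
  Fintype.card ι = Fintype.card κ ∧
    ∀ (E : Type u) [Field E] [CharP E p] (f : F →+* E),
      defect p (f ∘ a) = defect p (f ∘ b)

/-- Weak Vishik equivalence: same dimension, and equal defects over every field
extension of the shape `E = F(α)` with `αᵖ ∈ F` (this includes `E = F`). -/
def WeakVishikEquiv (p : ℕ) [Fact p.Prime] {F : Type u} [Field F] [CharP F p]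
    {ι κ : Type*} [Fintype ι] [Fintype κ] (a : ι → F) (b : κ → F) : Prop :=
  Fintype.card ι = Fintype.card κ ∧
    ∀ (E : Type u) [Field E] [CharP E p] (f : F →+* E) (α : E),
      α ^ p ∈ Set.range ⇑f →
      Subfield.closure (insert α (Set.range ⇑f)) = ⊤ →
      defect p (f ∘ a) = defect p (f ∘ b)

/-- The set `Fᵖ` of `p`-th powers. -/
def pSet (p : ℕ) (F : Type*) [Field F] : Set F := Set.range fun x : F => x ^ p

/-- The subfield `Fᵖ` of `p`-th powers (in characteristic `p` the set of `p`-th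
powers is already a subfield, so the closure adds nothing). -/
def pthSubfield (p : ℕ) (F : Type*) [Field F] : Subfield F :=
  Subfield.closure (pSet p F)

/-- The subfield `Fᵖ(s)` generated by a set `s` over `Fᵖ`. -/
def adjoin (p : ℕ) {F : Type*} [Field F] (s : Set F) : Subfield F :=
  Subfield.closure (pSet p F ∪ s)

/-- The degree `[N : k]` of a subfield `N` over a subfield `k` (for `k ≤ N`,
the `k`-span of `N` in `F` is `N` itself, so this is the `k`-dimension of `N`). -/
noncomputable def degOver {F : Type*} [Field F] (k : Subfield F) (N : Subfield F) : ℕ :=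
  Module.finrank k (Submodule.span k (N : Set F))

/-- The set `D_F(φ)` of values of the form. -/
def values (p : ℕ) {F : Type*} [CommRing F] {ι : Type*} [Fintype ι] (a : ι → F) : Set F :=
  Set.range (eval p a)

/-- The norm field `N_F(φ)`: the subfield generated over `Fᵖ` by all quotients
of nonzero values of `φ`. -/
def normField (p : ℕ) {F : Type*} [Field F] {ι : Type*} [Fintype ι] (a : ι → F) : Subfield F :=
  adjoin p {z : F | ∃ u ∈ values p a, ∃ v ∈ values p a, u ≠ 0 ∧ v ≠ 0 ∧ z = u / v}

/-- The norm degree `ndeg_F(φ) = [N_F(φ) : Fᵖ]`. -/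
noncomputable def ndeg (p : ℕ) {F : Type*} [Field F] {ι : Type*} [Fintype ι] (a : ι → F) : ℕ :=
  degOver (pthSubfield p F) (normField p a)

/-- An anisotropic form is minimal if `ndeg_F(φ) = p^(dim φ - 1)`. -/
def Minimal (p : ℕ) {F : Type*} [Field F] {ι : Type*} [Fintype ι] (a : ι → F) : Prop :=
  Anisotropic p a ∧ ndeg p a = p ^ (Fintype.card ι - 1)

/-- The quasi-Pfister form `⟪b₁,…,bₙ⟫`: its coefficients are all products
`b₁^{e₁}⋯bₙ^{eₙ}` with `0 ≤ eᵢ ≤ p-1`. -/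
def pfister (p : ℕ) {F : Type*} [CommRing F] {n : ℕ} (b : Fin n → F) :
    (Fin n → Fin p) → F :=
  fun e => ∏ i, b i ^ (e i : ℕ)

/-- A form is a quasi-Pfister form if it is isometric to some `⟪b₁,…,bₙ⟫`
with all `bᵢ ∈ F×`. -/
def IsQuasiPfister (p : ℕ) {F : Type*} [Field F] {ι : Type*} [Fintype ι] (a : ι → F) : Prop :=
  ∃ (n : ℕ) (b : Fin n → F), (∀ i, b i ≠ 0) ∧ Isometric p a (pfister p b)

/-- `a` is a quasi-Pfister neighbor of the form `π`: `c·a ⊆ π` for some `c ≠ 0`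
and `p · dim a > dim π`. -/
def IsNeighborOf (p : ℕ) {F : Type*} [Field F] {ι κ : Type*} [Fintype ι] [Fintype κ]
    (a : ι → F) (π : κ → F) : Prop :=
  ∃ c : F, c ≠ 0 ∧ Subform p (fun i => c * a i) π ∧ p * Fintype.card ι > Fintype.card κ

/-- `a` is a quasi-Pfister neighbor (of some quasi-Pfister form). -/
def IsQPNeighbor (p : ℕ) {F : Type*} [Field F] {ι : Type*} [Fintype ι] (a : ι → F) : Prop :=
  ∃ (n : ℕ) (b : Fin n → F), (∀ i, b i ≠ 0) ∧ IsNeighborOf p a (pfister p b)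

/-- `a` is a quasi-Pfister neighbor of codimension one of some anisotropic
quasi-Pfister form: `dim π - dim a = 1`. -/
def IsQPNeighborCodimOne (p : ℕ) {F : Type*} [Field F] {ι : Type*} [Fintype ι]
    (a : ι → F) : Prop :=
  ∃ (n : ℕ) (b : Fin n → F), (∀ i, b i ≠ 0) ∧ Anisotropic p (pfister p b) ∧
    IsNeighborOf p a (pfister p b) ∧ Fintype.card ι + 1 = p ^ n

/-- Tensor product of diagonal forms: coefficients `aᵢ · bⱼ`. -/
def tensor (p : ℕ) {F : Type*} [CommRing F] {ι κ : Type*}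
    (a : ι → F) (b : κ → F) : ι × κ → F :=
  fun ik => a ik.1 * b ik.2

/-- The set `G_F(φ) = {x ∈ F× : xφ ≃ φ} ∪ {0}` of similarity factors. -/
def simFactors (p : ℕ) {F : Type*} [Field F] {ι : Type*} [Fintype ι] (a : ι → F) : Set F :=
  {x | x ≠ 0 ∧ Isometric p (fun i => x * a i) a} ∪ {0}

/-- `b` is the anisotropic part of `a`: `b` is anisotropic and
`a ≃ b ⊥ (m × ⟨0⟩)` for some `m`. -/
def IsAnisotropicPart (p : ℕ) {F : Type*} [Field F] {ι κ : Type*} [Fintype ι] [Fintype κ]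
    (a : ι → F) (b : κ → F) : Prop :=
  Anisotropic p b ∧ ∃ m : ℕ, Isometric p a (Sum.elim b fun _ : Fin m => (0 : F))

/-- `⟪c₁,…,cₘ⟫` is (a representative of) the norm form of `a`:
`N_F(a) = Fᵖ(c₁,…,cₘ)` and `ndeg_F(a) = pᵐ`. -/
def IsNormForm (p : ℕ) {F : Type*} [Field F] {ι : Type*} [Fintype ι] (a : ι → F)
    {m : ℕ} (c : Fin m → F) : Prop :=
  normField p a = adjoin p (Set.range c) ∧ ndeg p a = p ^ m

end QLF

namespace QLF

open scoped Pointwise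

section Pair
variable {F : Type*} [Field F] {K : Subfield F}

lemma mul_mem_of_mem {S : Submodule K F} {k x : F} (hk : k ∈ K) (hx : x ∈ S) : k * x ∈ S :=
  S.smul_mem ⟨k, hk⟩ hx

lemma mul_inv_mem {S : Submodule K F} (hK : ∀ x : F, x ^ 2 ∈ K) {x y : F} (hy : y ∈ S)
    (hxy : x * y ∈ S) : x * y⁻¹ ∈ S := by
  rcases eq_or_ne y 0 with rfl | h
  · simp
  · have := mul_mem_of_mem (hK y⁻¹) hxy
    convert this using 1
    field_simp

lemma inv_mem_of_mem {S : Submodule K F} (hK : ∀ x : F, x ^ 2 ∈ K) {y : F} (hy : y ∈ S) :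
    y⁻¹ ∈ S := by
  have := mul_inv_mem (x := 1) hK hy (by simpa using hy)
  simpa using this

lemma mul_mem_of_mul_mem {S : Submodule K F} (hK : ∀ x : F, x ^ 2 ∈ K) {x y w : F}
    (hx : x ≠ 0) (hxy : x * y ∈ K) (hxw : x * w ∈ S) : y * w ∈ S := by
  have := mul_mem_of_mem (K.mul_mem (hK x⁻¹) hxy) hxw
  convert this using 1
  field_simp

/-- Every alternating pairing `f ∧ g` on `S` factors through the multiplication of `F`. -/
def PairingsFactor (S : Submodule K F) : Prop :=
  ∀ f g : F →ₗ[K] K, ∃ l : F →ₗ[K] K, ∀ u ∈ S, ∀ v ∈ S, l (u * v) = f u * g v + g u * f v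

lemma exists_eq_add_mul {S : Submodule K F} (hK : ∀ x : F, x ^ 2 ∈ K) (hS : PairingsFactor S)
    {p q w : F} (hp : p ∈ S) (hq : q ∈ S) (hpq : p * q ∉ K) (hwp : w * p ∈ S)
    (hwq : w * q ∈ S) : ∃ k ∈ K, ∃ d ∈ K, w = k + d * (p * q) := by
  have hp0 : p ≠ 0 := by rintro rfl; exact hpq (by simp)
  have hq0 : q ≠ 0 := by rintro rfl; exact hpq (by simp)
  have hp' : w * p⁻¹ ∈ S := mul_inv_mem hK hp hwp
  have hq' : w * q⁻¹ ∈ S := mul_inv_mem hK hq hwq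
  by_cases hmem : w * p⁻¹ ∈ Submodule.span K {p, q}
  · obtain ⟨a, b, hab⟩ := Submodule.mem_span_pair.1 hmem
    refine ⟨a * p ^ 2, K.mul_mem a.2 (hK p), b, b.2, ?_⟩
    have hw : w = w * p⁻¹ * p := by field_simp
    rw [hw, ← hab, Subfield.smul_def, Subfield.smul_def, smul_eq_mul, smul_eq_mul]
    ring
  · exfalso
    obtain ⟨g, hg, hgk⟩ := Submodule.exists_le_ker_of_notMem hmem
    have hpn : p ∉ Submodule.span K {q} := by
      intro h
      obtain ⟨a, ha⟩ := Submodule.mem_span_singleton.1 h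
      apply hpq
      rw [← ha, Subfield.smul_def, smul_eq_mul, mul_assoc, ← pow_two]
      exact K.mul_mem a.2 (hK q)
    obtain ⟨f, hf, hfk⟩ := Submodule.exists_le_ker_of_notMem hpn
    obtain ⟨l, hl⟩ := hS f g
    have hgp : g p = 0 := hgk (Submodule.subset_span (by simp))
    have hgq : g q = 0 := hgk (Submodule.subset_span (by simp))
    have hfq : f q = 0 := hfk (Submodule.subset_span (by simp))
    have h1 := hl p hp _ hp'
    have h2 := hl q hq _ hq'
    rw [show p * (w * p⁻¹) = w by field_simp, hgp, zero_mul, add_zero] at h1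
    rw [show q * (w * q⁻¹) = w by field_simp, hgq, hfq, zero_mul, zero_mul, add_zero, h1] at h2
    exact (mul_ne_zero hf hg) h2

lemma mul_mem_of_linear_relation (hK : ∀ x : F, x ^ 2 ∈ K) {a b u v : F} (ha : a ∈ K)
    (hb : b ∈ K) (h : a * u + b * v = 0) (hab : a ≠ 0 ∨ b ≠ 0) : u * v ∈ K := by
  rcases hab with h0 | h0
  · have : u * v = -(a⁻¹ * b * v ^ 2) := by
      field_simp
      linear_combination v * h
    rw [this]
    exact K.neg_mem (K.mul_mem (K.mul_mem (K.inv_mem ha) hb) (hK v))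
  · have : u * v = -(b⁻¹ * a * u ^ 2) := by
      field_simp
      linear_combination u * h
    rw [this]
    exact K.neg_mem (K.mul_mem (K.mul_mem (K.inv_mem hb) ha) (hK u))

lemma exists_functional {M ι : Type*} [Fintype ι] [AddCommGroup M] [Module K M] {v : ι → M}
    (hv : LinearIndependent K v) (h : ι → K) : ∃ l : M →ₗ[K] K, ∀ i, l (v i) = h i := by
  classical
  obtain ⟨g, hg⟩ := LinearMap.exists_leftInverse_of_injective (Fintype.linearCombination K v)
    (LinearMap.ker_eq_bot.2 hv.fintypeLinearCombination_injective)
  refine ⟨Fintype.linearCombination K h ∘ₗ g, fun i => ?_⟩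
  have : g (v i) = Pi.single i 1 := by
    have := LinearMap.congr_fun hg (Pi.single i 1)
    simpa using this
  simp [this]

/-- The Plücker relation: a sum of two products of elements of `S` that is again such a product
forces the two products to share a factor. -/
lemma exists_common_factor [CharP F 2] {S : Submodule K F} (hK : ∀ x : F, x ^ 2 ∈ K)
    (hS : PairingsFactor S) (hS0 : S ≠ ⊥) {u v u' v' u'' v'' : F} (hu : u ∈ S) (hv : v ∈ S)
    (hu' : u' ∈ S) (hv' : v' ∈ S) (hu'' : u'' ∈ S) (hv'' : v'' ∈ S)
    (h : u * v + u' * v' = u'' * v'') :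
    ∃ z ∈ S, z ≠ 0 ∧ z * (u * v) ∈ S ∧ z * (u' * v') ∈ S := by
  have key : ∀ {a b x y : F}, a ∈ K → b ∈ K → x ∈ S → y ∈ S →
      (a * x + b * y) * (x * y) ∈ S := by
    intro a b x y ha hb hx hy
    have : (a * x + b * y) * (x * y) = (a * x ^ 2) * y + (b * y ^ 2) * x := by ring
    rw [this]
    exact S.add_mem (mul_mem_of_mem (K.mul_mem ha (hK x)) hy)
      (mul_mem_of_mem (K.mul_mem hb (hK y)) hx)
  by_cases hw : u * v ∈ K
  · by_cases hw' : u' * v' ∈ K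
    · obtain ⟨z, hz, hz0⟩ := S.exists_mem_ne_zero_of_ne_bot hS0
      exact ⟨z, hz, hz0, by rw [mul_comm]; exact mul_mem_of_mem hw hz,
        by rw [mul_comm]; exact mul_mem_of_mem hw' hz⟩
    · refine ⟨u', hu', by rintro rfl; exact hw' (by simp), ?_, ?_⟩
      · rw [mul_comm]; exact mul_mem_of_mem hw hu'
      · simpa using key K.one_mem K.zero_mem hu' hv'
  by_cases hw' : u' * v' ∈ K
  · refine ⟨u, hu, by rintro rfl; exact hw (by simp), ?_, ?_⟩
    · simpa using key K.one_mem K.zero_mem hu hv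
    · rw [mul_comm]; exact mul_mem_of_mem hw' hu
  by_cases hli : LinearIndependent K ![u, v, u', v']
  · exfalso
    have hex := fun i : Fin 4 => exists_functional hli (Pi.single i 1)
    choose f hf using hex
    have e : ∀ i, f i u = (Pi.single i 1 : Fin 4 → K) 0 ∧ f i v = (Pi.single i 1 : Fin 4 → K) 1 ∧
        f i u' = (Pi.single i 1 : Fin 4 → K) 2 ∧ f i v' = (Pi.single i 1 : Fin 4 → K) 3 :=
      fun i => ⟨hf i 0, hf i 1, hf i 2, hf i 3⟩
    have P : ∀ i j, (f i u * f j v + f j u * f i v) + (f i u' * f j v' + f j u' * f i v') =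
        f i u'' * f j v'' + f j u'' * f i v'' := by
      intro i j
      obtain ⟨l, hl⟩ := hS (f i) (f j)
      rw [← hl u hu v hv, ← hl u' hu' v' hv', ← hl u'' hu'' v'' hv'', ← map_add, h]
    have h01 := P 0 1
    have h23 := P 2 3
    have h02 := P 0 2
    have h13 := P 1 3
    have h03 := P 0 3
    have h12 := P 1 2
    simp [e] at h01 h23 h02 h13 h03 h12
    have h2 : (2 : K) = 0 := by
      apply Subtype.ext
      exact CharTwo.two_eq_zero (R := F)
    have : (1 : K) = 0 := by
      generalize f 0 u'' = a0, f 1 u'' = a1, f 2 u'' = a2, f 3 u'' = a3,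
        f 0 v'' = b0, f 1 v'' = b1, f 2 v'' = b2, f 3 v'' = b3 at *
      have : (a0 * b1 + a1 * b0) * (a2 * b3 + a3 * b2) = 1 := by rw [← h01, ← h23, one_mul]
      have h5 : (a0 * b2 + a2 * b0) * (a1 * b3 + a3 * b1) = 0 := by rw [← h02, zero_mul]
      have h6 : (a0 * b3 + a3 * b0) * (a1 * b2 + a2 * b1) = 0 := by rw [← h03, zero_mul]
      linear_combination (-1 : K) * this - h5 - h6 +
        (a0 * b1 * a2 * b3 + a0 * b1 * a3 * b2 + a1 * b0 * a2 * b3 + a1 * b0 * a3 * b2 +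
          a0 * b2 * a1 * b3 + a2 * b0 * a3 * b1) * h2
    exact one_ne_zero this
  · rw [Fintype.not_linearIndependent_iff] at hli
    obtain ⟨c, hc, i, hi⟩ := hli
    simp only [Fin.sum_univ_four, Matrix.cons_val, Subfield.smul_def, smul_eq_mul] at hc
    by_cases hz : (c 0 : F) * u + c 1 * v = 0
    · exfalso
      have h01 : c 0 = 0 ∧ c 1 = 0 := by
        by_contra hne
        refine hw (mul_mem_of_linear_relation hK (c 0).2 (c 1).2 hz ?_)
        simpa [imp_iff_not_or] using hne
      have h23 : c 2 = 0 ∧ c 3 = 0 := by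
        by_contra hne
        refine hw' (mul_mem_of_linear_relation hK (c 2).2 (c 3).2 ?_ ?_)
        · linear_combination hc - hz
        · simpa [imp_iff_not_or] using hne
      fin_cases i <;> simp_all
    · refine ⟨_, S.add_mem (mul_mem_of_mem (c 0).2 hu) (mul_mem_of_mem (c 1).2 hv), hz,
        key (c 0).2 (c 1).2 hu hv, ?_⟩
      have : (c 0 : F) * u + c 1 * v = -((c 2 : F) * u' + c 3 * v') := by linear_combination hc
      rw [this, neg_mul]
      exact S.neg_mem (key (c 2).2 (c 3).2 hu' hv')

lemma finrank_smul {S : Submodule K F} {d : F} (hd : d ≠ 0) :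
    Module.finrank K (d • S : Submodule K F) = Module.finrank K S :=
  (LinearEquiv.finrank_eq (Submodule.equivMapOfInjective
    (DistribSMul.toLinearMap K F d) (mul_right_injective₀ hd) S)).symm

lemma mem_smul_iff {S : Submodule K F} {d x : F} (hd : d ≠ 0) : x ∈ d • S ↔ d⁻¹ * x ∈ S := by
  rw [Submodule.mem_smul_pointwise_iff_exists]
  constructor
  · rintro ⟨y, hy, rfl⟩
    simpa [hd] using hy
  · intro h
    exact ⟨_, h, by simp [hd]⟩

lemma eq_smul_of_mul_mem {S T : Submodule K F} [FiniteDimensional K T] {d : F} (hd : d ≠ 0)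
    (h : ∀ x ∈ S, d * x ∈ T) (hr : Module.finrank K S = Module.finrank K T) : T = d • S := by
  symm
  refine Submodule.eq_of_le_of_finrank_eq ?_ (by rw [finrank_smul hd, hr])
  intro x hx
  rw [mem_smul_iff hd] at hx
  simpa [hd] using h _ hx

/-- All products of two elements of `S` are products of two elements of `T`. -/
def ProductsLE (S T : Submodule K F) : Prop :=
  ∀ x ∈ S, ∀ y ∈ S, ∃ u ∈ T, ∃ v ∈ T, x * y = u * v

lemma ProductsLE.smul_left (hK : ∀ x : F, x ^ 2 ∈ K) {S T : Submodule K F} {d : F} (hd : d ≠ 0)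
    (h : ProductsLE S T) : ProductsLE (d • S) T := by
  intro x hx y hy
  rw [mem_smul_iff hd] at hx hy
  obtain ⟨u, hu, v, hv, e⟩ := h _ hx _ hy
  refine ⟨d ^ 2 * u, mul_mem_of_mem (hK d) hu, v, hv, ?_⟩
  rw [mul_assoc, ← e]
  field_simp

lemma ProductsLE.smul_right (hK : ∀ x : F, x ^ 2 ∈ K) {S T : Submodule K F} {d : F} (hd : d ≠ 0)
    (h : ProductsLE S T) : ProductsLE S (d • T) := by
  intro x hx y hy
  obtain ⟨u, hu, v, hv, e⟩ := h _ hx _ hy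
  refine ⟨d⁻¹ * u, ?_, d * v, ?_, ?_⟩
  · rw [mem_smul_iff hd, ← mul_assoc, ← pow_two]
    exact mul_mem_of_mem (hK d⁻¹) hu
  · rw [mem_smul_iff hd]
    simpa [hd] using hv
  · rw [e]
    field_simp

lemma mem_of_decomposable [CharP F 2] {S T : Submodule K F} (hK : ∀ x : F, x ^ 2 ∈ K)
    (hS : PairingsFactor S) (hS0 : S ≠ ⊥)
    (hT : ∀ w ∈ T, ∃ u ∈ S, ∃ v ∈ S, w = u * v) {w₀ w₁ w x : F}
    (hw₀ : w₀ ∈ T) (hw₁ : w₁ ∈ T) (hw : w ∈ T) (hw₀K : w₀ ∉ K)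
    (hli : ∀ k ∈ K, ∀ d ∈ K, w₁ ≠ k + d * w₀) (hx : x ∈ S) (hx₀ : x * w₀ ∈ S)
    (hx₁ : x * w₁ ∈ S) (hxw : x * w ∉ S) :
    ∃ a ∈ K, ∃ b ∈ K, ∃ c ∈ K, ∃ d ∈ K, w = a + b * w₀ + c * w₁ + d * (w₀ * w₁) := by
  have common : ∀ {w w' : F}, w ∈ T → w' ∈ T → ∃ z ∈ S, z ≠ 0 ∧ z * w ∈ S ∧ z * w' ∈ S := by
    intro w w' hw hw'
    obtain ⟨u, hu, v, hv, rfl⟩ := hT w hw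
    obtain ⟨u', hu', v', hv', rfl⟩ := hT w' hw'
    obtain ⟨u'', hu'', v'', hv'', e⟩ := hT _ (T.add_mem hw hw')
    exact exists_common_factor hK hS hS0 hu hv hu' hv' hu'' hv'' e
  have hx0 : x ≠ 0 := by rintro rfl; simp at hxw
  obtain ⟨p, hp, hp0, hpw₀, hpw⟩ := common hw₀ hw
  obtain ⟨q, hq, hq0, hqw₁, hqw⟩ := common hw₁ hw
  have hxp : x * p ∉ K := fun h => hxw (mul_mem_of_mul_mem hK hp0 (by rwa [mul_comm]) hpw)
  have hxq : x * q ∉ K := fun h => hxw (mul_mem_of_mul_mem hK hq0 (by rwa [mul_comm]) hqw)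
  obtain ⟨k₀, hk₀, d₀, hd₀, e₀⟩ := exists_eq_add_mul hK hS hx hp hxp
    (by rwa [mul_comm]) (by rwa [mul_comm]) (w := w₀)
  obtain ⟨k₁, hk₁, d₁, hd₁, e₁⟩ := exists_eq_add_mul hK hS hx hq hxq
    (by rwa [mul_comm]) (by rwa [mul_comm]) (w := w₁)
  have hd₀0 : d₀ ≠ 0 := by
    rintro rfl
    exact hw₀K (by rw [e₀]; simpa using hk₀)
  have hd₁0 : d₁ ≠ 0 := by
    rintro rfl
    exact hli k₁ hk₁ 0 K.zero_mem (by rw [e₁]; ring)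
  have hxp' : x * p = d₀⁻¹ * (w₀ - k₀) := by rw [e₀]; field_simp; ring
  have hxq' : x * q = d₁⁻¹ * (w₁ - k₁) := by rw [e₁]; field_simp; ring
  have hpq : p * q ∉ K := by
    intro h
    have hp₁ : p * w₁ ∈ S := mul_mem_of_mul_mem hK hq0 (by rwa [mul_comm]) hqw₁
    obtain ⟨k, hk, d, hd, e⟩ := exists_eq_add_mul hK hS hx hp hxp
      (by rwa [mul_comm]) (by rwa [mul_comm]) (w := w₁)
    refine hli (k - d * d₀⁻¹ * k₀) ?_ (d * d₀⁻¹) (K.mul_mem hd (K.inv_mem hd₀)) ?_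
    · exact K.sub_mem hk (K.mul_mem (K.mul_mem hd (K.inv_mem hd₀)) hk₀)
    · rw [e, hxp']; ring
  obtain ⟨k, hk, d, hd, e⟩ := exists_eq_add_mul hK hS hp hq hpq
    (by rwa [mul_comm]) (by rwa [mul_comm]) (w := w)
  have hpq' : p * q = (x⁻¹ ^ 2 * (d₀⁻¹ * d₁⁻¹)) * ((w₀ - k₀) * (w₁ - k₁)) := by
    have : p * q = x⁻¹ ^ 2 * ((x * p) * (x * q)) := by field_simp
    rw [this, hxp', hxq']; ring
  have hc : d * (x⁻¹ ^ 2 * (d₀⁻¹ * d₁⁻¹)) ∈ K :=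
    K.mul_mem hd (K.mul_mem (hK _) (K.mul_mem (K.inv_mem hd₀) (K.inv_mem hd₁)))
  generalize x⁻¹ ^ 2 * (d₀⁻¹ * d₁⁻¹) = c at *
  refine ⟨k + d * c * (k₀ * k₁), K.add_mem hk (K.mul_mem hc (K.mul_mem hk₀ hk₁)),
    -(d * c * k₁), K.neg_mem (K.mul_mem hc hk₁), -(d * c * k₀), K.neg_mem (K.mul_mem hc hk₀),
    d * c, hc, ?_⟩
  rw [e, hpq']; ring

lemma eq_smul_of_mul_closed {S T : Submodule K F} [FiniteDimensional K S] [FiniteDimensional K T]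
    (hr : Module.finrank K S = Module.finrank K T) (hS0 : S ≠ ⊥)
    (hmul : ∀ x ∈ T, ∀ y ∈ T, x * y ∈ T) (hST : ProductsLE S T) : ∃ d : F, d ≠ 0 ∧ T = d • S := by
  obtain ⟨z, hz, hz0⟩ := S.exists_mem_ne_zero_of_ne_bot hS0
  refine ⟨z, hz0, eq_smul_of_mul_mem hz0 (fun x hx => ?_) hr⟩
  obtain ⟨u, hu, v, hv, e⟩ := hST z hz x hx
  rw [e]
  exact hmul u hu v hv

/-- A subspace containing `1` and having the same products as a subspace whose alternating
pairings factor is similar to it. -/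
lemma eq_smul_of_pairingsFactor_of_one_mem [CharP F 2] {S T : Submodule K F}
    [FiniteDimensional K S] [FiniteDimensional K T] (hK : ∀ x : F, x ^ 2 ∈ K)
    (hr : Module.finrank K S = Module.finrank K T) (hS0 : S ≠ ⊥) (hS : PairingsFactor S)
    (h1 : 1 ∈ T) (hST : ProductsLE S T) (hTS : ProductsLE T S) : ∃ d : F, d ≠ 0 ∧ T = d • S := by
  have hT : ∀ w ∈ T, ∃ u ∈ S, ∃ v ∈ S, w = u * v := by
    intro w hw
    simpa using hTS w hw 1 h1
  by_cases hz : ∃ z ∈ S, z ≠ 0 ∧ ∀ w ∈ T, z * w ∈ S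
  · obtain ⟨z, hz, hz0, h⟩ := hz
    have e := eq_smul_of_mul_mem hz0 h hr.symm
    exact ⟨z⁻¹, inv_ne_zero hz0, by rw [e, inv_smul_smul₀ hz0]⟩
  push Not at hz
  obtain ⟨z, hzS, hz0⟩ := S.exists_mem_ne_zero_of_ne_bot hS0
  have hKS : ∀ {z w : F}, z ∈ S → z * w ∉ S → w ∉ K := fun hz hzw hw =>
    hzw (by rw [mul_comm]; exact mul_mem_of_mem hw hz)
  obtain ⟨w₀, hw₀, hzw₀⟩ := hz z hzS hz0
  have hw₀K := hKS hzS hzw₀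
  obtain ⟨u, hu, v, hv, e₀⟩ := hT w₀ hw₀
  have hu0 : u ≠ 0 := by rintro rfl; exact hw₀K (by simp [e₀])
  have huw₀ : u * w₀ ∈ S := by
    rw [e₀, ← mul_assoc, ← pow_two]
    exact mul_mem_of_mem (hK u) hv
  obtain ⟨w₁, hw₁, huw₁⟩ := hz u hu hu0
  have hli : ∀ k ∈ K, ∀ d ∈ K, w₁ ≠ k + d * w₀ := by
    rintro k hk d hd rfl
    apply huw₁
    rw [mul_add, mul_comm u k, mul_left_comm]
    exact S.add_mem (mul_mem_of_mem hk hu) (mul_mem_of_mem hd huw₀)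
  obtain ⟨x, hx, hx0, hxw₀, hxw₁⟩ : ∃ x ∈ S, x ≠ 0 ∧ x * w₀ ∈ S ∧ x * w₁ ∈ S := by
    obtain ⟨u', hu', v', hv', rfl⟩ := hT w₁ hw₁
    obtain ⟨u'', hu'', v'', hv'', e⟩ := hT _ (T.add_mem hw₀ hw₁)
    subst e₀
    exact exists_common_factor hK hS hS0 hu hv hu' hv' hu'' hv'' e
  obtain ⟨w₂, hw₂, hxw₂⟩ := hz x hx hx0
  have hmem : ∀ w ∈ T, x * w ∉ S →
      ∃ a ∈ K, ∃ b ∈ K, ∃ c ∈ K, ∃ d ∈ K, w = a + b * w₀ + c * w₁ + d * (w₀ * w₁) :=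
    fun w hw hxw => mem_of_decomposable hK hS hS0 hT hw₀ hw₁ hw hw₀K hli hx hxw₀ hxw₁ hxw
  have hsum : ∀ {a b c : F}, a ∈ K → b ∈ K → c ∈ K → a + b * w₀ + c * w₁ ∈ T := by
    intro a b c ha hb hc
    refine T.add_mem (T.add_mem ?_ (mul_mem_of_mem hb hw₀)) (mul_mem_of_mem hc hw₁)
    simpa using mul_mem_of_mem ha h1
  have hprod : w₀ * w₁ ∈ T := by
    obtain ⟨a, ha, b, hb, c, hc, d, hd, e⟩ := hmem w₂ hw₂ hxw₂
    have hd0 : d ≠ 0 := by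
      rintro rfl
      apply hxw₂
      rw [e, show x * (a + b * w₀ + c * w₁ + 0 * (w₀ * w₁)) =
        a * x + b * (x * w₀) + c * (x * w₁) by ring]
      exact S.add_mem (S.add_mem (mul_mem_of_mem ha hx) (mul_mem_of_mem hb hxw₀))
        (mul_mem_of_mem hc hxw₁)
    have := mul_mem_of_mem (K.inv_mem hd) (T.sub_mem hw₂ (hsum ha hb hc))
    rwa [show d⁻¹ * (w₂ - (a + b * w₀ + c * w₁)) = w₀ * w₁ by rw [e]; field_simp; ring] at this
  have hall : ∀ w ∈ T,
      ∃ a ∈ K, ∃ b ∈ K, ∃ c ∈ K, ∃ d ∈ K, w = a + b * w₀ + c * w₁ + d * (w₀ * w₁) := by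
    intro w hw
    by_cases hxw : x * w ∈ S
    · have hx' : x * (w + w₂) ∉ S := by
        intro h
        apply hxw₂
        simpa [mul_add] using S.sub_mem h hxw
      obtain ⟨a, ha, b, hb, c, hc, d, hd, e⟩ := hmem _ (T.add_mem hw hw₂) hx'
      obtain ⟨a', ha', b', hb', c', hc', d', hd', e'⟩ := hmem _ hw₂ hxw₂
      refine ⟨a - a', K.sub_mem ha ha', b - b', K.sub_mem hb hb', c - c', K.sub_mem hc hc',
        d - d', K.sub_mem hd hd', ?_⟩
      linear_combination e - e'
    · exact hmem w hw hxw
  refine eq_smul_of_mul_closed hr hS0 (fun s hs t ht => ?_) hST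
  have hmul₀ : ∀ t ∈ T, w₀ * t ∈ T := by
    intro t ht
    obtain ⟨a, ha, b, hb, c, hc, d, hd, rfl⟩ := hall t ht
    have h := T.add_mem (hsum (K.mul_mem hb (hK w₀)) ha (K.mul_mem hd (hK w₀)))
      (mul_mem_of_mem hc hprod)
    convert h using 1
    ring
  have hmul₁ : ∀ t ∈ T, w₁ * t ∈ T := by
    intro t ht
    obtain ⟨a, ha, b, hb, c, hc, d, hd, rfl⟩ := hall t ht
    have h := T.add_mem (hsum (K.mul_mem hc (hK w₁)) (K.mul_mem hd (hK w₁)) ha)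
      (mul_mem_of_mem hb hprod)
    convert h using 1
    ring
  obtain ⟨a, ha, b, hb, c, hc, d, hd, rfl⟩ := hall s hs
  have := T.add_mem (T.add_mem (T.add_mem (mul_mem_of_mem ha ht)
    (mul_mem_of_mem hb (hmul₀ t ht))) (mul_mem_of_mem hc (hmul₁ t ht)))
    (mul_mem_of_mem hd (hmul₀ _ (hmul₁ t ht)))
  convert this using 1
  ring

/-- Two hyperplanes in a finite-dimensional subalgebra of `F` are similar. -/
lemma exists_eq_smul_of_hyperplanes {L H₁ H₂ : Submodule K F} [FiniteDimensional K L]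
    (hL : ∀ x ∈ L, ∀ y ∈ L, x * y ∈ L) (h₁ : H₁ ≤ L) (h₂ : H₂ ≤ L)
    (hr₁ : Module.finrank K H₁ + 1 = Module.finrank K L)
    (hr₂ : Module.finrank K H₂ + 1 = Module.finrank K L) : ∃ d : F, d ≠ 0 ∧ H₂ = d • H₁ := by
  have hfun : ∀ {H : Submodule K F}, H ≤ L → Module.finrank K H + 1 = Module.finrank K L →
      ∃ f : F →ₗ[K] K, (∃ x ∈ L, f x ≠ 0) ∧ ∀ x ∈ L, f x = 0 ↔ x ∈ H := by
    intro H hH hr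
    have hne : ∃ y ∈ L, y ∉ H := by
      by_contra! hc
      rw [le_antisymm hH hc] at hr
      omega
    obtain ⟨y, hy, hyH⟩ := hne
    obtain ⟨f, hf, hfH⟩ := Submodule.exists_le_ker_of_notMem hyH
    refine ⟨f, ⟨y, hy, hf⟩, fun x hx => ⟨fun hfx => ?_, fun hxH => hfH hxH⟩⟩
    have : H = L ⊓ LinearMap.ker f := by
      refine Submodule.eq_of_le_of_finrank_le (le_inf hH hfH) ?_
      have : Module.finrank K ↥(L ⊓ LinearMap.ker f) < Module.finrank K L := by
        refine Submodule.finrank_lt_finrank_of_lt (lt_of_le_of_ne inf_le_left ?_)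
        intro h
        have hy' : y ∈ L ⊓ LinearMap.ker f := by rw [h]; exact hy
        exact hf hy'.2
      omega
    rw [this]
    exact ⟨hx, hfx⟩
  obtain ⟨f, ⟨y, hy, hfy⟩, hf⟩ := hfun h₁ hr₁
  obtain ⟨g, ⟨y', hy', hgy'⟩, hg⟩ := hfun h₂ hr₂
  let Φ : L →ₗ[K] Module.Dual K L :=
    (LinearMap.mul K F).compl₁₂ L.subtype L.subtype |>.compr₂ f
  have hΦ : ∀ a x : L, Φ a x = f (a * x) := fun a x => rfl
  have hinj : Function.Injective Φ := by
    rw [injective_iff_map_eq_zero]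
    intro a ha
    by_contra ha0
    have ha0' : (a : F) ≠ 0 := fun h => ha0 (Subtype.ext h)
    have hfin : ∃ x : L, (a : F) * x = y := by
      let m : L →ₗ[K] L := ((LinearMap.mulLeft K (a : F)) ∘ₗ L.subtype).codRestrict L
        (fun x => hL _ a.2 _ x.2)
      have hm : Function.Injective m := by
        intro s t hst
        have := congrArg Subtype.val hst
        exact Subtype.ext (mul_left_cancel₀ ha0' this)
      obtain ⟨x, hx⟩ := LinearMap.injective_iff_surjective.1 hm ⟨y, hy⟩
      exact ⟨x, congrArg Subtype.val hx⟩
    obtain ⟨x, hx⟩ := hfin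
    apply hfy
    rw [← hx, ← hΦ, ha]
    rfl
  have hdual : FiniteDimensional K (Module.Dual K L) :=
    Subspace.instModuleDualFiniteDimensional
  obtain ⟨a, ha⟩ := (LinearMap.injective_iff_surjective_of_finrank_eq_finrank
    (Subspace.dual_finrank_eq (K := K) (V := L)).symm).1 hinj (g.domRestrict L)
  have hga : ∀ x ∈ L, g x = f (a * x) := fun x hx => by
    rw [← hΦ a ⟨x, hx⟩, ha]; rfl
  have ha0 : (a : F) ≠ 0 := by
    intro h0
    apply hgy'
    rw [hga y' hy', h0, zero_mul, map_zero]
  have : FiniteDimensional K H₁ := Submodule.finiteDimensional_of_le h₁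
  have e : H₁ = (a : F) • H₂ := by
    refine eq_smul_of_mul_mem ha0 (fun x hx => ?_) (by omega)
    rw [← hf _ (hL _ a.2 _ (h₂ hx)), ← hga x (h₂ hx), hg x (h₂ hx)]
    exact hx
  exact ⟨(a : F)⁻¹, inv_ne_zero ha0, by rw [e, inv_smul_smul₀ ha0]⟩

end Pair

section Forms
variable {F : Type*} [Field F] {ι κ : Type*}

/-- The span over `F²` of the coefficients of a form, i.e. its set of values. -/
abbrev valueSpan (a : ι → F) : Submodule (pthSubfield 2 F) F :=
  Submodule.span (pthSubfield 2 F) (Set.range a)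

instance finiteDimensional_valueSpan [Finite ι] (a : ι → F) :
    FiniteDimensional (pthSubfield 2 F) (valueSpan a) :=
  FiniteDimensional.span_of_finite _ (Set.finite_range _)

lemma valueSpan_const_mul (c : F) (a : ι → F) :
    valueSpan (fun i => c * a i) = c • valueSpan a := by
  rw [valueSpan, ← Submodule.span_smul, ← Set.range_smul]
  rfl

lemma valueSpan_sumElim (a : ι → F) (b : κ → F) :
    valueSpan (Sum.elim a b) = valueSpan a ⊔ valueSpan b := by
  rw [valueSpan, Set.Sum.elim_range, Submodule.span_union]

lemma one_mem_valueSpan_pfister {n : ℕ} (b : Fin n → F) : 1 ∈ valueSpan (pfister 2 b) :=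
  Submodule.subset_span ⟨0, by simp [pfister]⟩

variable [Fintype ι] [Fintype κ]

lemma finrank_valueSpan_le (a : ι → F) :
    Module.finrank (pthSubfield 2 F) (valueSpan a) ≤ Fintype.card ι :=
  finrank_range_le_card a

lemma Isometric.card_eq {a : ι → F} {b : κ → F} (h : Isometric 2 a b) :
    Fintype.card ι = Fintype.card κ := by
  obtain ⟨T, -⟩ := h
  simpa using T.finrank_eq

variable [CharP F 2]

lemma mem_pthSubfield {x : F} : x ∈ pthSubfield 2 F ↔ ∃ y : F, y ^ 2 = x := by
  have : pSet 2 F = ((frobenius F 2).fieldRange : Set F) := by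
    ext; simp [pSet, frobenius_def]
  rw [pthSubfield, this, Subfield.closure_eq]
  simp [frobenius_def]

lemma sq_mem_pthSubfield (x : F) : x ^ 2 ∈ pthSubfield 2 F := mem_pthSubfield.2 ⟨x, rfl⟩

lemma mem_valueSpan {a : ι → F} {z : F} : z ∈ valueSpan a ↔ ∃ x, eval 2 a x = z := by
  rw [Submodule.mem_span_range_iff_exists_fun]
  constructor
  · rintro ⟨c, hc⟩
    choose x hx using fun i => mem_pthSubfield.1 (c i).2
    refine ⟨x, ?_⟩
    rw [← hc]
    exact Finset.sum_congr rfl fun i _ => by rw [hx, Subfield.smul_def, smul_eq_mul, mul_comm]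
  · rintro ⟨x, hx⟩
    refine ⟨fun i => ⟨x i ^ 2, sq_mem_pthSubfield _⟩, ?_⟩
    rw [← hx]
    exact Finset.sum_congr rfl fun i _ => by rw [Subfield.smul_def, smul_eq_mul, mul_comm]

lemma Anisotropic.linearIndependent {a : ι → F} (ha : Anisotropic 2 a) :
    LinearIndependent (pthSubfield 2 F) a := by
  rw [Fintype.linearIndependent_iff]
  intro c hc i
  choose x hx using fun i => mem_pthSubfield.1 (c i).2
  have hx0 : x = 0 := by
    by_contra h0
    refine ha ⟨x, h0, ?_⟩
    rw [← hc]
    exact Finset.sum_congr rfl fun i _ => by rw [hx, Subfield.smul_def, smul_eq_mul, mul_comm]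
  apply Subtype.ext
  rw [← hx i, hx0]
  simp

lemma Anisotropic.finrank_valueSpan {a : ι → F} (ha : Anisotropic 2 a) :
    Module.finrank (pthSubfield 2 F) (valueSpan a) = Fintype.card ι :=
  finrank_span_eq_card ha.linearIndependent

lemma Subform.valueSpan_le {a : ι → F} {b : κ → F} (h : Subform 2 a b) :
    valueSpan a ≤ valueSpan b := by
  obtain ⟨T, -, hT⟩ := h
  intro z hz
  obtain ⟨x, rfl⟩ := mem_valueSpan.1 hz
  exact mem_valueSpan.2 ⟨T x, (hT x).symm⟩

lemma Isometric.valueSpan_eq {a : ι → F} {b : κ → F} (h : Isometric 2 a b) :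
    valueSpan a = valueSpan b := by
  obtain ⟨T, hT⟩ := h
  refine le_antisymm (Subform.valueSpan_le ⟨T, T.injective, hT⟩)
    (Subform.valueSpan_le ⟨T.symm, T.symm.injective, fun x => ?_⟩)
  rw [LinearEquiv.coe_coe, hT, T.apply_symm_apply]

lemma similar_of_valueSpan_eq {a : ι → F} {b : κ → F} (ha : Anisotropic 2 a)
    (hcard : Fintype.card ι = Fintype.card κ) {c : F} (hc : c ≠ 0)
    (h : valueSpan a = c • valueSpan b) : Similar 2 a b := by
  classical
  refine ⟨c, hc, ?_⟩
  rw [← valueSpan_const_mul] at h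
  have hex : ∀ i, ∃ t, eval 2 (fun i => c * b i) t = a i := fun i =>
    mem_valueSpan.1 (h ▸ Submodule.subset_span ⟨i, rfl⟩)
  choose t ht using hex
  let T : (ι → F) →ₗ[F] (κ → F) := Fintype.linearCombination F t
  have hT : ∀ x, eval 2 a x = eval 2 (fun i => c * b i) (T x) := by
    intro x
    have key : eval 2 (fun i => c * b i) (T x) =
        ∑ i, x i ^ 2 * eval 2 (fun i => c * b i) (t i) := by
      simp only [T, Fintype.linearCombination_apply, eval, Finset.sum_apply, Pi.smul_apply,
        smul_eq_mul, sum_pow_char, Finset.mul_sum, mul_pow]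
      rw [Finset.sum_comm]
      exact Finset.sum_congr rfl fun i _ => Finset.sum_congr rfl fun j _ => by ring
    rw [key]
    exact Finset.sum_congr rfl fun i _ => by rw [ht, mul_comm]
  have hinj : Function.Injective T := by
    rw [injective_iff_map_eq_zero]
    intro x hx
    by_contra hx0
    refine ha ⟨x, hx0, ?_⟩
    rw [hT, hx]
    simp [eval]
  exact ⟨LinearEquiv.ofInjectiveOfFinrankEq T hinj (by simpa using hcard), hT⟩

section Pfister
variable {n : ℕ} (b : Fin n → F)

lemma pfister_mul_mem (e e' : Fin n → Fin 2) :
    pfister 2 b e * pfister 2 b e' ∈ valueSpan (pfister 2 b) := by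
  have key : pfister 2 b e * pfister 2 b e' =
      (∏ i, b i ^ ((e i : ℕ) * (e' i : ℕ))) ^ 2 * pfister 2 b (e + e') := by
    simp only [pfister]
    rw [← Finset.prod_mul_distrib, ← Finset.prod_pow, ← Finset.prod_mul_distrib]
    refine Finset.prod_congr rfl fun i _ => ?_
    rw [Pi.add_apply]
    generalize e i = s, e' i = s'
    fin_cases s <;> fin_cases s' <;> simp [pow_two]
  rw [key]
  exact mul_mem_of_mem (sq_mem_pthSubfield _) (Submodule.subset_span ⟨_, rfl⟩)

lemma mul_mem_valueSpan_pfister : ∀ x ∈ valueSpan (pfister 2 b),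
    ∀ y ∈ valueSpan (pfister 2 b), x * y ∈ valueSpan (pfister 2 b) := by
  intro x hx y hy
  induction hx, hy using Submodule.span_induction₂ with
  | mem_mem x y hx hy =>
    obtain ⟨e, rfl⟩ := hx
    obtain ⟨e', rfl⟩ := hy
    exact pfister_mul_mem b e e'
  | zero_left y hy => simp
  | zero_right x hx => simp
  | add_left x y z _ _ _ h h' => rw [add_mul]; exact Submodule.add_mem _ h h'
  | add_right x y z _ _ _ h h' => rw [mul_add]; exact Submodule.add_mem _ h h'
  | smul_left r x y _ _ h => rw [smul_mul_assoc]; exact Submodule.smul_mem _ _ h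
  | smul_right r x y _ _ h => rw [mul_smul_comm]; exact Submodule.smul_mem _ _ h

end Pfister

end Forms

section Vishik

lemma finrank_sup_smul {F : Type*} [Field F] {K : Subfield F} {ι : Type*} [Fintype ι]
    (hK : ∀ x : F, x ^ 2 ∈ K) (φ : ι → F) (a : F) :
    let E := IntermediateField.adjoin K {a}
    Module.finrank K ↥(Submodule.span K (Set.range φ) ⊔ a • Submodule.span K (Set.range φ)) =
      Module.finrank K E * Module.finrank E (Submodule.span E (Set.range φ)) := by
  intro E
  set V := Submodule.span K (Set.range φ) with hV
  have ha : a ∈ E := IntermediateField.mem_adjoin_simple_self K a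
  have hclosed : ∀ e ∈ E, ∀ x ∈ V ⊔ a • V, e * x ∈ V ⊔ a • V := by
    intro e he
    induction he using IntermediateField.adjoin_induction with
    | mem e he =>
      rw [Set.mem_singleton_iff] at he
      subst he
      intro x hx
      obtain ⟨y, hy, z, hz, rfl⟩ := Submodule.mem_sup.1 hx
      obtain ⟨t, ht, rfl⟩ := (Submodule.mem_smul_pointwise_iff_exists _ _ _).1 hz
      rw [mul_add, add_comm]
      refine Submodule.add_mem_sup ?_ (Submodule.smul_mem_pointwise_smul _ _ _ hy)
      rw [smul_eq_mul, ← mul_assoc, ← pow_two]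
      exact mul_mem_of_mem (hK _) ht
    | algebraMap k =>
      intro x hx
      exact Submodule.smul_mem _ k hx
    | add x y _ _ hx hy =>
      intro z hz
      rw [add_mul]
      exact Submodule.add_mem _ (hx z hz) (hy z hz)
    | inv x _ hx =>
      intro z hz
      rcases eq_or_ne x 0 with rfl | h0
      · simp
      · have := mul_mem_of_mem (hK x⁻¹) (hx z hz)
        convert this using 1
        field_simp
    | mul x y _ _ hx hy =>
      intro z hz
      rw [mul_assoc]
      exact hx _ (hy z hz)
  have hle : ∀ x ∈ V, x ∈ Submodule.span E (Set.range φ) := by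
    intro x hx
    exact Submodule.span_le_restrictScalars K E _ hx
  have heq : (Submodule.span E (Set.range φ)).restrictScalars K = V ⊔ a • V := by
    apply le_antisymm
    · let M : Submodule E F :=
        { carrier := (V ⊔ a • V : Submodule K F)
          add_mem' := fun hx hy => Submodule.add_mem _ hx hy
          zero_mem' := Submodule.zero_mem _
          smul_mem' := fun e x hx => hclosed e e.2 x hx }
      have : Submodule.span E (Set.range φ) ≤ M :=
        Submodule.span_le.2 fun x hx => Submodule.mem_sup_left (Submodule.subset_span hx)
      exact this
    · refine sup_le hle ?_
      intro x hx
      obtain ⟨z, hz, rfl⟩ := (Submodule.mem_smul_pointwise_iff_exists _ _ _).1 hx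
      exact Submodule.smul_mem _ (⟨a, ha⟩ : E) (hle z hz)
  rw [← heq]
  exact (Module.finrank_mul_finrank K E (Submodule.span E (Set.range φ))).symm

variable {F : Type u} [Field F] [CharP F 2]

/-- The isomorphism of `F(√a)` with `F²(a)`, restricted to `F`. -/
def sqHom (E : IntermediateField (pthSubfield 2 F) F) : F →+* E :=
  (algebraMap (pthSubfield 2 F) E).comp
    ((frobenius F 2).codRestrict (pthSubfield 2 F) sq_mem_pthSubfield)

lemma coe_sqHom (E : IntermediateField (pthSubfield 2 F) F) (x : F) :
    (sqHom E x : F) = x ^ 2 := rfl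

lemma defect_sqHom {ι : Type*} [Fintype ι] (φ : ι → F)
    (E : IntermediateField (pthSubfield 2 F) F) :
    defect 2 (sqHom E ∘ φ) + Module.finrank E (Submodule.span E (Set.range φ)) =
      Fintype.card ι := by
  have hker : zeroSubmodule 2 (sqHom E ∘ φ) = LinearMap.ker (Fintype.linearCombination E φ) := by
    ext x
    change eval 2 (sqHom E ∘ φ) x = 0 ↔ _
    have key : ((eval 2 (sqHom E ∘ φ) x : E) : F) = (∑ i, x i • φ i) ^ 2 := by
      rw [sum_pow_char]
      simp [eval, coe_sqHom, IntermediateField.smul_def, mul_pow, mul_comm]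
    rw [LinearMap.mem_ker, Fintype.linearCombination_apply,
      ← pow_eq_zero_iff (a := ∑ i, x i • φ i) two_ne_zero, ← key, ZeroMemClass.coe_eq_zero]
  rw [defect, hker, ← Fintype.range_linearCombination, add_comm,
    LinearMap.finrank_range_add_finrank_ker, Module.finrank_fintype_fun_eq_card]

lemma closure_insert_range_sqHom (a : F) :
    Subfield.closure (insert ⟨a, IntermediateField.mem_adjoin_simple_self (pthSubfield 2 F) a⟩
      (Set.range (sqHom (IntermediateField.adjoin (pthSubfield 2 F) {a})))) = ⊤ := by
  rw [eq_top_iff]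
  rintro ⟨e, he⟩ -
  induction he using IntermediateField.adjoin_induction with
  | mem e he =>
    rw [Set.mem_singleton_iff] at he
    subst he
    exact Subfield.subset_closure (Set.mem_insert _ _)
  | algebraMap k =>
    obtain ⟨y, hy⟩ := mem_pthSubfield.1 k.2
    refine Subfield.subset_closure (Set.mem_insert_of_mem _ ⟨y, ?_⟩)
    exact Subtype.ext hy
  | add x y hx hy h h' => exact Subfield.add_mem _ h h'
  | inv x hx h => exact Subfield.inv_mem _ h
  | mul x y hx hy h h' => exact Subfield.mul_mem _ h h'

lemma WeakVishikEquiv.finrank_sup_smul_eq {ι κ : Type*} [Fintype ι] [Fintype κ] {φ : ι → F}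
    {ψ : κ → F} (h : WeakVishikEquiv 2 φ ψ) (a : F) :
    Module.finrank (pthSubfield 2 F) ↥(valueSpan φ ⊔ a • valueSpan φ) =
      Module.finrank (pthSubfield 2 F) ↥(valueSpan ψ ⊔ a • valueSpan ψ) := by
  obtain ⟨hcard, h⟩ := h
  rw [finrank_sup_smul sq_mem_pthSubfield, finrank_sup_smul sq_mem_pthSubfield]
  have hd := h _ (sqHom (IntermediateField.adjoin (pthSubfield 2 F) {a}))
    ⟨a, IntermediateField.mem_adjoin_simple_self _ a⟩ ⟨a, rfl⟩ (closure_insert_range_sqHom a)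
  have h₁ := defect_sqHom φ (IntermediateField.adjoin (pthSubfield 2 F) {a})
  have h₂ := defect_sqHom ψ (IntermediateField.adjoin (pthSubfield 2 F) {a})
  congr 1
  omega

end Vishik

section Minimal
variable {F : Type*} [Field F] [CharP F 2]

lemma linearIndependent_pfister_of_minimal {m : ℕ} {σ : Fin (m + 1) → F} (h : Minimal 2 σ) :
    LinearIndependent (pthSubfield 2 F) (pfister 2 fun k : Fin m => σ k.succ / σ 0) := by
  obtain ⟨han, hdeg⟩ := h
  have hσ0 : σ 0 ≠ 0 := han.linearIndependent.ne_zero 0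
  set t : Fin m → F := fun k => σ k.succ / σ 0 with ht
  have hcoef : ∀ i, σ i / σ 0 ∈ valueSpan (pfister 2 t) := by
    intro i
    refine Fin.cases ?_ (fun k => ?_) i
    · rw [div_self hσ0]
      exact one_mem_valueSpan_pfister t
    · refine Submodule.subset_span ⟨Pi.single k 1, ?_⟩
      rw [pfister, Finset.prod_eq_single k] <;> simp +contextual [ht]
  have hval : ∀ u ∈ values 2 σ, u / σ 0 ∈ valueSpan (pfister 2 t) := by
    rintro _ ⟨x, rfl⟩
    rw [eval, Finset.sum_div]
    refine Submodule.sum_mem _ fun i _ => ?_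
    rw [mul_div_right_comm, mul_comm]
    exact mul_mem_of_mem (sq_mem_pthSubfield _) (hcoef i)
  let N : Subfield F :=
    { carrier := valueSpan (pfister 2 t)
      mul_mem' := fun hx hy => mul_mem_valueSpan_pfister t _ hx _ hy
      one_mem' := one_mem_valueSpan_pfister t
      add_mem' := fun hx hy => Submodule.add_mem _ hx hy
      zero_mem' := Submodule.zero_mem _
      neg_mem' := fun hx => Submodule.neg_mem _ hx
      inv_mem' := fun x hx => inv_mem_of_mem sq_mem_pthSubfield hx }
  have hN : normField 2 σ ≤ N := by
    refine Subfield.closure_le.2 ?_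
    rintro z (⟨y, rfl⟩ | ⟨u, hu, v, hv, hu0, hv0, rfl⟩)
    · change y ^ 2 ∈ valueSpan (pfister 2 t)
      simpa using mul_mem_of_mem (sq_mem_pthSubfield y) (one_mem_valueSpan_pfister t)
    · have := N.div_mem (hval u hu) (hval v hv)
      rwa [div_div_div_cancel_right₀ hσ0] at this
  rw [linearIndependent_iff_card_le_finrank_span]
  have hle : Submodule.span (pthSubfield 2 F) (normField 2 σ : Set F) ≤ valueSpan (pfister 2 t) :=
    Submodule.span_le.2 hN
  have := Submodule.finrank_mono hle
  rw [ndeg, degOver] at hdeg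
  rw [hdeg] at this
  simpa [Set.finrank] using this

lemma pairingsFactor_of_minimal {m : ℕ} {σ : Fin (m + 1) → F} (h : Minimal 2 σ) :
    PairingsFactor (valueSpan σ) := by
  classical
  have hli := linearIndependent_pfister_of_minimal h
  have hσ0 : σ 0 ≠ 0 := h.1.linearIndependent.ne_zero 0
  intro f g
  let ε : {p : Fin (m + 1) × Fin (m + 1) // p.1 < p.2} → Fin m → Fin 2 :=
    fun p k => if k.succ = p.1.1 ∨ k.succ = p.1.2 then 1 else 0
  have hεiff : ∀ p k, ε p k = 1 ↔ (k.succ = p.1.1 ∨ k.succ = p.1.2) := by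
    intro p k
    by_cases hk : k.succ = p.1.1 ∨ k.succ = p.1.2 <;> simp [ε, hk]
  have hsucc : ∀ p q : {p : Fin (m + 1) × Fin (m + 1) // p.1 < p.2}, ε p = ε q →
      ∀ k : Fin (m + 1), k ≠ 0 → (k = p.1.1 ∨ k = p.1.2) → (k = q.1.1 ∨ k = q.1.2) := by
    intro p q hpq k hk hkp
    obtain ⟨k, rfl⟩ := Fin.exists_succ_eq.2 hk
    rwa [← hεiff, ← hpq, hεiff]
  have hε : Function.Injective ε := by
    rintro p q hpq
    have h₁ := hsucc p q hpq
    have h₂ := hsucc q p hpq.symm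
    obtain ⟨⟨i, j⟩, hp⟩ := p
    obtain ⟨⟨i', j'⟩, hq⟩ := q
    simp only at hp hq h₁ h₂
    have hi := fun h => h₁ i h (Or.inl rfl)
    have hj := h₁ j (Fin.ne_zero_of_lt hp) (Or.inr rfl)
    have hi' := fun h => h₂ i' h (Or.inl rfl)
    have hj' := h₂ j' (Fin.ne_zero_of_lt hq) (Or.inr rfl)
    simp only [Subtype.mk.injEq, Prod.mk.injEq]
    simp only [Fin.ext_iff, Fin.lt_def, Fin.val_zero, ne_eq] at hp hq hi hj hi' hj' ⊢
    omega
  have hε0 : ∀ p, ε p ≠ 0 := by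
    rintro ⟨⟨i, j⟩, hp⟩ h0
    obtain ⟨k, rfl⟩ := Fin.exists_succ_eq.2 (Fin.ne_zero_of_lt hp)
    have := congrFun h0 k
    simp [ε] at this
  have hprod : ∀ p, σ p.1.1 * σ p.1.2 =
      σ 0 ^ 2 * pfister 2 (fun k : Fin m => σ k.succ / σ 0) (ε p) := by
    rintro ⟨⟨i, j⟩, hp⟩
    have key : pfister 2 (fun k : Fin m => σ k.succ / σ 0) (ε ⟨(i, j), hp⟩) =
        ∏ k ∈ {i, j}, σ k / σ 0 := by
      rw [← Finset.univ_inter {i, j}, ← Finset.prod_ite_mem, Fin.prod_univ_succ, div_self hσ0,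
        ite_self, one_mul]
      refine Finset.prod_congr rfl fun k _ => ?_
      by_cases hk : k.succ = i ∨ k.succ = j <;> simp [ε, hk]
    rw [key, Finset.prod_pair (ne_of_lt hp)]
    field_simp
  let β : {p : Fin (m + 1) × Fin (m + 1) // p.1 < p.2} → pthSubfield 2 F := fun p =>
    ⟨(σ 0)⁻¹ ^ 2, sq_mem_pthSubfield _⟩ *
      (f (σ p.1.1) * g (σ p.1.2) + g (σ p.1.1) * f (σ p.1.2))
  obtain ⟨l, hl⟩ := exists_functional hli (Function.extend ε β 0)
  have hl1 : l 1 = 0 := by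
    have := hl 0
    rw [Function.extend_apply' _ _ _ (by rintro ⟨p, hp⟩; exact hε0 p hp)] at this
    simpa [pfister] using this
  have hlsq : ∀ x : F, l (x ^ 2) = 0 := by
    intro x
    have := l.map_smul ⟨x ^ 2, sq_mem_pthSubfield x⟩ 1
    rwa [hl1, smul_zero, Subfield.smul_def, smul_eq_mul, mul_one] at this
  have hlt : ∀ i j, i < j → l (σ i * σ j) = f (σ i) * g (σ j) + g (σ i) * f (σ j) := by
    intro i j hij
    have := l.map_smul ⟨σ 0 ^ 2, sq_mem_pthSubfield _⟩
      (pfister 2 (fun k : Fin m => σ k.succ / σ 0) (ε ⟨(i, j), hij⟩))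
    rw [Subfield.smul_def, smul_eq_mul, ← hprod, hl, hε.extend_apply, smul_eq_mul,
      ← mul_assoc] at this
    rw [this]
    convert one_mul _
    apply Subtype.ext
    simp [hσ0]
  refine ⟨l, fun u hu v hv => ?_⟩
  have htwo : ∀ x : pthSubfield 2 F, x + x = 0 := fun x =>
    Subtype.ext (CharTwo.add_self_eq_zero (x : F))
  induction hu, hv using Submodule.span_induction₂ with
  | mem_mem x y hx hy =>
    obtain ⟨i, rfl⟩ := hx
    obtain ⟨j, rfl⟩ := hy
    rcases lt_trichotomy i j with hij | rfl | hij
    · exact hlt i j hij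
    · rw [← pow_two, hlsq, mul_comm (g _), htwo]
    · rw [mul_comm, hlt j i hij]; ring
  | zero_left y hy => simp
  | zero_right x hx => simp
  | add_left x y z _ _ _ h h' => rw [add_mul, map_add, h, h', map_add, map_add]; ring
  | add_right x y z _ _ _ h h' => rw [mul_add, map_add, h, h', map_add, map_add]; ring
  | smul_left r x y _ _ h =>
    rw [smul_mul_assoc, map_smul, h, map_smul, map_smul]; simp only [smul_eq_mul]; ring
  | smul_right r x y _ _ h =>
    rw [mul_smul_comm, map_smul, h, map_smul, map_smul]; simp only [smul_eq_mul]; ring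

end Minimal

section Neighbor
variable {F : Type*} [Field F] {K : Subfield F}

instance finiteDimensional_smul {S : Submodule K F} [FiniteDimensional K S] (d : F) :
    FiniteDimensional K ↥(d • S) :=
  inferInstanceAs (FiniteDimensional K ↥(S.map (DistribSMul.toLinearMap K F d)))

lemma productsLE_of_finrank_sup_smul {S T : Submodule K F} [FiniteDimensional K S]
    [FiniteDimensional K T] (hK : ∀ x : F, x ^ 2 ∈ K) (hT0 : T ≠ ⊥)
    (hr : Module.finrank K S = Module.finrank K T)
    (h : ∀ x ∈ S, ∀ y ∈ S, x * y ∉ K → Module.finrank K ↥(S ⊔ (x * y) • S) =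
      Module.finrank K ↥(T ⊔ (x * y) • T)) : ProductsLE S T := by
  intro x hx y hy
  by_cases hxy : x * y ∈ K
  · obtain ⟨t, ht, ht0⟩ := T.exists_mem_ne_zero_of_ne_bot hT0
    refine ⟨x * y * t, mul_mem_of_mem hxy ht, t⁻¹, inv_mem_of_mem hK ht, ?_⟩
    field_simp
  · have h0 : x * y ≠ 0 := fun h0 => hxy (h0 ▸ K.zero_mem)
    obtain ⟨hx0, hy0⟩ := mul_ne_zero_iff.1 h0
    have hxmem : x ∈ S ⊓ (x * y) • S := by
      refine ⟨hx, (mem_smul_iff h0).2 ?_⟩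
      rw [show (x * y)⁻¹ * x = y⁻¹ by field_simp]
      exact inv_mem_of_mem hK hy
    have hS := Submodule.finrank_sup_add_finrank_inf_eq S ((x * y) • S)
    have hT := Submodule.finrank_sup_add_finrank_inf_eq T ((x * y) • T)
    have e := h x hx y hy hxy
    rw [finrank_smul h0] at hS hT
    have hSne : S ⊓ (x * y) • S ≠ ⊥ := fun hbot => hx0 ((Submodule.mem_bot K).1 (hbot ▸ hxmem))
    have hSpos : Module.finrank K ↥(S ⊓ (x * y) • S) ≠ 0 := by
      rwa [ne_eq, Submodule.finrank_eq_zero]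
    have hTne : T ⊓ (x * y) • T ≠ ⊥ := by
      rw [ne_eq, ← Submodule.finrank_eq_zero (R := K)]
      omega
    obtain ⟨z, ⟨hz, hz'⟩, hz0⟩ := Submodule.exists_mem_ne_zero_of_ne_bot hTne
    refine ⟨z, hz, _, inv_mem_of_mem hK ((mem_smul_iff h0).1 hz'), ?_⟩
    field_simp

lemma inf_smul_eq_bot {P X : Submodule K F} (hK : ∀ x : F, x ^ 2 ∈ K)
    (hP : ∀ x ∈ P, ∀ y ∈ P, x * y ∈ P) (hX : X ≤ P) {b : F} (hb : b ∉ P) : P ⊓ b • X = ⊥ := by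
  rw [eq_bot_iff]
  rintro z ⟨hz, hz'⟩
  obtain ⟨x, hx, rfl⟩ := (Submodule.mem_smul_pointwise_iff_exists _ _ _).1 hz'
  rcases eq_or_ne x 0 with rfl | hx0
  · simp
  · refine absurd ?_ hb
    have := hP _ hz _ (inv_mem_of_mem hK (hX hx))
    rwa [smul_eq_mul, mul_inv_cancel_right₀ hx0] at this

lemma finrank_sup_smul_of_le {P X : Submodule K F} [FiniteDimensional K P]
    (hK : ∀ x : F, x ^ 2 ∈ K) (hP : ∀ x ∈ P, ∀ y ∈ P, x * y ∈ P) (hX : X ≤ P) {b : F}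
    (hb : b ∉ P) :
    Module.finrank K ↥(P ⊔ b • X) = Module.finrank K P + Module.finrank K X := by
  have hX' : FiniteDimensional K X := Submodule.finiteDimensional_of_le hX
  have hb0 : b ≠ 0 := fun h => hb (h ▸ P.zero_mem)
  have := Submodule.finrank_sup_add_finrank_inf_eq P (b • X)
  rw [inf_smul_eq_bot hK hP hX hb, finrank_bot, finrank_smul hb0] at this
  omega

lemma smul_eq_self_of_mem {P : Submodule K F} [FiniteDimensional K P]
    (hP : ∀ x ∈ P, ∀ y ∈ P, x * y ∈ P) {a : F} (ha : a ∈ P) (ha0 : a ≠ 0) : a • P = P :=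
  (eq_smul_of_mul_mem ha0 (fun x hx => hP a ha x hx) rfl).symm

/-- A subspace containing the field `P` that is indistinguishable from `P ⊔ b • S` is of the
form `P ⊔ b • T` with `T` indistinguishable from `S`. -/
lemma exists_eq_sup_smul {P S W : Submodule K F} [FiniteDimensional K P] [FiniteDimensional K W]
    (hK : ∀ x : F, x ^ 2 ∈ K) (h1 : 1 ∈ P) (hP : ∀ x ∈ P, ∀ y ∈ P, x * y ∈ P) (hS : S ≤ P)
    (hS0 : S ≠ ⊥) {b : F} (hb : b ∉ P) (hPW : P ≤ W)
    (hr : Module.finrank K ↥(P ⊔ b • S) = Module.finrank K W)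
    (H : ∀ a : F, Module.finrank K ↥((P ⊔ b • S) ⊔ a • (P ⊔ b • S)) =
      Module.finrank K ↥(W ⊔ a • W)) :
    ∃ T ≤ P, W = P ⊔ b • T ∧ Module.finrank K T = Module.finrank K S ∧
      ProductsLE S T ∧ ProductsLE T S := by
  have hb0 : b ≠ 0 := fun h => hb (h ▸ P.zero_mem)
  have hSfin : FiniteDimensional K S := Submodule.finiteDimensional_of_le hS
  have hVne : P ⊔ b • S ≠ ⊥ := fun h => one_ne_zero
    ((Submodule.mem_bot K).1 (h ▸ Submodule.mem_sup_left h1))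
  have hWV := productsLE_of_finrank_sup_smul hK hVne hr.symm fun x _ y _ _ => (H (x * y)).symm
  have hWle : W ≤ P ⊔ b • P := by
    intro w hw
    obtain ⟨u, hu, v, hv, e⟩ := hWV w hw 1 (hPW h1)
    rw [mul_one] at e
    obtain ⟨p, hp, z, hz, rfl⟩ := Submodule.mem_sup.1 hu
    obtain ⟨q, hq, z', hz', rfl⟩ := Submodule.mem_sup.1 hv
    obtain ⟨s, hs, rfl⟩ := (Submodule.mem_smul_pointwise_iff_exists _ _ _).1 hz
    obtain ⟨t, ht, rfl⟩ := (Submodule.mem_smul_pointwise_iff_exists _ _ _).1 hz'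
    rw [e, smul_eq_mul, smul_eq_mul, show (p + b * s) * (q + b * t) =
      (p * q + b ^ 2 * (s * t)) + b * (p * t + s * q) by ring]
    refine Submodule.add_mem_sup (P.add_mem (hP _ hp _ hq)
      (mul_mem_of_mem (hK b) (hP _ (hS hs) _ (hS ht)))) ?_
    exact Submodule.smul_mem_pointwise_smul _ _ _
      (P.add_mem (hP _ hp _ (hS ht)) (hP _ (hS hs) _ hq))
  have hT : ∃ T ≤ P, W = P ⊔ b • T := by
    refine ⟨P ⊓ b⁻¹ • W, inf_le_left, le_antisymm (fun w hw => ?_) (sup_le hPW fun w hw => ?_)⟩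
    · obtain ⟨p, hp, z, hz, rfl⟩ := Submodule.mem_sup.1 (hWle hw)
      obtain ⟨q, hq, rfl⟩ := (Submodule.mem_smul_pointwise_iff_exists _ _ _).1 hz
      refine Submodule.add_mem_sup hp (Submodule.smul_mem_pointwise_smul _ _ _ ⟨hq, ?_⟩)
      rw [SetLike.mem_coe, mem_smul_iff (inv_ne_zero hb0), inv_inv]
      simpa using W.sub_mem hw (hPW hp)
    · obtain ⟨q, hq, rfl⟩ := (Submodule.mem_smul_pointwise_iff_exists _ _ _).1 hw
      have := (mem_smul_iff (inv_ne_zero hb0)).1 hq.2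
      rwa [inv_inv] at this
  obtain ⟨T, hTP, rfl⟩ := hT
  have hTfin : FiniteDimensional K T := Submodule.finiteDimensional_of_le hTP
  have hrST : Module.finrank K S = Module.finrank K T := by
    rw [finrank_sup_smul_of_le hK hP hS hb, finrank_sup_smul_of_le hK hP hTP hb] at hr
    omega
  have hT0 : T ≠ ⊥ := by
    rw [ne_eq, ← Submodule.finrank_eq_zero (R := K), ← hrST, Submodule.finrank_eq_zero]
    exact hS0
  have hsup : ∀ X ≤ P, ∀ a ∈ P, a ≠ 0 → Module.finrank K ↥((P ⊔ b • X) ⊔ a • (P ⊔ b • X)) =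
      Module.finrank K P + Module.finrank K ↥(X ⊔ a • X) := by
    intro X hX a ha ha0
    have hle : a • X ≤ P := by
      intro z hz
      obtain ⟨x, hx, rfl⟩ := (Submodule.mem_smul_pointwise_iff_exists _ _ _).1 hz
      exact hP a ha x (hX hx)
    rw [← finrank_sup_smul_of_le hK hP (sup_le hX hle) hb, Submodule.smul_sup',
      Submodule.smul_sup', smul_eq_self_of_mem hP ha ha0, smul_comm a b, sup_sup_sup_comm,
      sup_idem]
  have key : ∀ x ∈ P, ∀ y ∈ P, x * y ∉ K →
      Module.finrank K ↥(S ⊔ (x * y) • S) = Module.finrank K ↥(T ⊔ (x * y) • T) := by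
    intro x hx y hy hxy
    have h0 : x * y ≠ 0 := fun h0 => hxy (h0 ▸ K.zero_mem)
    have := H (x * y)
    rw [hsup S hS _ (hP x hx y hy) h0, hsup T hTP _ (hP x hx y hy) h0] at this
    omega
  exact ⟨T, hTP, rfl, hrST.symm,
    productsLE_of_finrank_sup_smul hK hT0 hrST fun x hx y hy => key x (hS hx) y (hS hy),
    productsLE_of_finrank_sup_smul hK hS0 hrST.symm fun x hx y hy hxy =>
      (key x (hTP hx) y (hTP hy) hxy).symm⟩

/-- It suffices to recognise those subspaces indistinguishable from `S` that contain `1`. -/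
lemma exists_eq_smul_of_one_mem_case {S T : Submodule K F} (hK : ∀ x : F, x ^ 2 ∈ K)
    (hr : Module.finrank K T = Module.finrank K S) (hT0 : T ≠ ⊥) (hST : ProductsLE S T)
    (hTS : ProductsLE T S)
    (h : ∀ T' : Submodule K F, 1 ∈ T' → Module.finrank K T' = Module.finrank K S →
      ProductsLE S T' → ProductsLE T' S → ∃ d : F, d ≠ 0 ∧ T' = d • S) :
    ∃ d : F, d ≠ 0 ∧ T = d • S := by
  obtain ⟨t, ht, ht0⟩ := T.exists_mem_ne_zero_of_ne_bot hT0
  have hti := inv_ne_zero ht0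
  obtain ⟨d, hd0, hd⟩ := h (t⁻¹ • T) ((mem_smul_iff hti).2 (by simpa using ht))
    (by rw [finrank_smul hti, hr]) (hST.smul_right hK hti) (hTS.smul_left hK hti)
  refine ⟨t * d, mul_ne_zero ht0 hd0, ?_⟩
  rw [mul_smul, ← hd, smul_inv_smul₀ ht0]

lemma eq_smul_of_field {S T : Submodule K F} [FiniteDimensional K S]
    (hS : ∀ x ∈ S, ∀ y ∈ S, x * y ∈ S) (h1 : 1 ∈ T)
    (hr : Module.finrank K T = Module.finrank K S) (hTS : ProductsLE T S) :
    ∃ d : F, d ≠ 0 ∧ T = d • S := by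
  refine ⟨1, one_ne_zero, ?_⟩
  rw [one_smul]
  refine Submodule.eq_of_le_of_finrank_eq (fun x hx => ?_) hr
  obtain ⟨u, hu, v, hv, e⟩ := hTS x hx 1 h1
  rw [← mul_one x, e]
  exact hS u hu v hv

lemma eq_smul_of_hyperplane {L S T : Submodule K F} [FiniteDimensional K L]
    (hK : ∀ x : F, x ^ 2 ∈ K) (hL : ∀ x ∈ L, ∀ y ∈ L, x * y ∈ L) {a : F} (ha : a ≠ 0)
    (hSL : a • S ≤ L) (hrS : Module.finrank K S + 1 = Module.finrank K L) (h1 : 1 ∈ T)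
    (hr : Module.finrank K T = Module.finrank K S) (hTS : ProductsLE T S) :
    ∃ d : F, d ≠ 0 ∧ T = d • S := by
  have hTL : T ≤ L := by
    intro x hx
    obtain ⟨u, hu, v, hv, e⟩ := hTS x hx 1 h1
    have := mul_mem_of_mem (hK a⁻¹) (hL _ (hSL (Submodule.smul_mem_pointwise_smul u a S hu)) _
      (hSL (Submodule.smul_mem_pointwise_smul v a S hv)))
    convert this using 1
    rw [← mul_one x, e, smul_eq_mul, smul_eq_mul]
    field_simp
  obtain ⟨d, hd0, hd⟩ := exists_eq_smul_of_hyperplanes hL hSL hTL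
    (by rw [finrank_smul ha, hrS]) (by rw [hr, hrS])
  exact ⟨d * a, mul_ne_zero hd0 ha, by rw [mul_smul, hd]⟩

end Neighbor

section Special

lemma exists_eq_smul_valueSpan {F : Type*} [Field F] [CharP F 2] {s : ℕ} {σ : Fin s → F}
    {T : Submodule (pthSubfield 2 F) F} (hS0 : valueSpan σ ≠ ⊥)
    (hs : Module.finrank (pthSubfield 2 F) (valueSpan σ) = s)
    (hσ : IsQuasiPfister 2 σ ∨ IsQPNeighborCodimOne 2 σ ∨ Minimal 2 σ)
    (hr : Module.finrank (pthSubfield 2 F) T = Module.finrank (pthSubfield 2 F) (valueSpan σ))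
    (hST : ProductsLE (valueSpan σ) T) (hTS : ProductsLE T (valueSpan σ)) :
    ∃ d : F, d ≠ 0 ∧ T = d • valueSpan σ := by
  have hpos : 0 < Module.finrank (pthSubfield 2 F) (valueSpan σ) := by
    rwa [Nat.pos_iff_ne_zero, ne_eq, Submodule.finrank_eq_zero]
  have hT0 : T ≠ ⊥ := by
    rintro rfl
    rw [finrank_bot] at hr
    omega
  refine exists_eq_smul_of_one_mem_case sq_mem_pthSubfield hr hT0 hST hTS
    fun T' h1 hr' hST' hTS' => ?_
  have hT'fin : FiniteDimensional (pthSubfield 2 F) T' :=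
    Module.finite_of_finrank_pos (hr' ▸ hpos)
  rcases hσ with ⟨k, b, -, hiso⟩ | ⟨k, b, -, hbani, ⟨a, ha, hsub, -⟩, hcard⟩ | hmin
  · refine eq_smul_of_field ?_ h1 hr' hTS'
    rw [hiso.valueSpan_eq]
    exact mul_mem_valueSpan_pfister b
  · have hle := hsub.valueSpan_le
    rw [valueSpan_const_mul] at hle
    refine eq_smul_of_hyperplane sq_mem_pthSubfield (mul_mem_valueSpan_pfister b) ha hle ?_ h1
      hr' hTS'
    rw [hbani.finrank_valueSpan, hs]
    simpa using hcard
  · obtain _ | m := s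
    · omega
    · exact eq_smul_of_pairingsFactor_of_one_mem sq_mem_pthSubfield hr'.symm hS0
        (pairingsFactor_of_minimal hmin) h1 hST' hTS'

variable {F : Type u} [Field F] [CharP F 2]

lemma exists_eq_smul_sup_smul {r s : ℕ} (πc : Fin r → F) (b : F) (σ : Fin s → F)
    (hσπ : Subform 2 σ (pfister 2 πc))
    (hσ : IsQuasiPfister 2 σ ∨ IsQPNeighborCodimOne 2 σ ∨ Minimal 2 σ)
    {W : Submodule (pthSubfield 2 F) F} [FiniteDimensional (pthSubfield 2 F) W]
    (hPW : valueSpan (pfister 2 πc) ≤ W)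
    (hV : Module.finrank (pthSubfield 2 F) ↥(valueSpan (pfister 2 πc) ⊔ b • valueSpan σ) =
      2 ^ r + s)
    (hr : Module.finrank (pthSubfield 2 F) ↥(valueSpan (pfister 2 πc) ⊔ b • valueSpan σ) =
      Module.finrank (pthSubfield 2 F) W)
    (H : ∀ a : F, Module.finrank (pthSubfield 2 F)
      ↥((valueSpan (pfister 2 πc) ⊔ b • valueSpan σ) ⊔
        a • (valueSpan (pfister 2 πc) ⊔ b • valueSpan σ)) =
      Module.finrank (pthSubfield 2 F) ↥(W ⊔ a • W)) :
    ∃ d : F, d ≠ 0 ∧ W = d • (valueSpan (pfister 2 πc) ⊔ b • valueSpan σ) := by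
  have hPmul := mul_mem_valueSpan_pfister πc
  have h1 := one_mem_valueSpan_pfister πc
  have hSP := hσπ.valueSpan_le
  have hPr : Module.finrank (pthSubfield 2 F) (valueSpan (pfister 2 πc)) ≤ 2 ^ r := by
    simpa using finrank_valueSpan_le (pfister 2 πc)
  have hSs : Module.finrank (pthSubfield 2 F) (valueSpan σ) ≤ s := by
    simpa using finrank_valueSpan_le σ
  by_cases hbS : b • valueSpan σ ≤ valueSpan (pfister 2 πc)
  · refine ⟨1, one_ne_zero, ?_⟩
    rw [sup_eq_left.2 hbS] at hr ⊢
    rw [one_smul, Submodule.eq_of_le_of_finrank_eq hPW hr]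
  · have hb : b ∉ valueSpan (pfister 2 πc) := by
      refine fun hb => hbS fun z hz => ?_
      obtain ⟨x, hx, rfl⟩ := (Submodule.mem_smul_pointwise_iff_exists _ _ _).1 hz
      exact hPmul b hb x (hSP hx)
    have hS0 : valueSpan σ ≠ ⊥ := by
      intro h
      rw [h, Submodule.smul_bot'] at hbS
      exact hbS bot_le
    have hs : Module.finrank (pthSubfield 2 F) (valueSpan σ) = s := by
      rw [finrank_sup_smul_of_le sq_mem_pthSubfield hPmul hSP hb] at hV
      omega
    obtain ⟨T, hTP, rfl, hrT, hST, hTS⟩ :=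
      exists_eq_sup_smul sq_mem_pthSubfield h1 hPmul hSP hS0 hb hPW hr H
    obtain ⟨d, hd0, rfl⟩ := exists_eq_smul_valueSpan hS0 hs hσ hrT hST hTS
    refine ⟨d, hd0, ?_⟩
    obtain ⟨x, hx, hx0⟩ := (valueSpan σ).exists_mem_ne_zero_of_ne_bot hS0
    have hd : d ∈ valueSpan (pfister 2 πc) := by
      have := hPmul _ (hTP (Submodule.smul_mem_pointwise_smul x d _ hx)) _
        (inv_mem_of_mem sq_mem_pthSubfield (hSP hx))
      rwa [smul_eq_mul, mul_inv_cancel_right₀ hx0] at this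
    rw [Submodule.smul_sup', smul_eq_self_of_mem hPmul hd hd0, smul_comm b d]

/-- A form that is weakly Vishik equivalent to a special quasi-Pfister neighbor `(π, b, σ)` and
contains a multiple of `π` is similar to it, when `σ` is of one of the three given types. -/
lemma WeakVishikEquiv.similar_of_special {n m r s : ℕ} {φ : Fin n → F} {ψ : Fin m → F}
    (h : WeakVishikEquiv 2 φ ψ) (hφan : Anisotropic 2 φ) (hψan : Anisotropic 2 ψ)
    {πc : Fin r → F} {b : F} {σ : Fin s → F} (hσπ : Subform 2 σ (pfister 2 πc))
    (hspn : Similar 2 φ (Sum.elim (pfister 2 πc) fun j => b * σ j))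
    {c : F} (hc : c ≠ 0) (hcπ : Subform 2 (fun e => c * pfister 2 πc e) ψ)
    (hσ : IsQuasiPfister 2 σ ∨ IsQPNeighborCodimOne 2 σ ∨ Minimal 2 σ) : Similar 2 φ ψ := by
  obtain ⟨e, he, hiso⟩ := hspn
  have hcard := hiso.card_eq
  have hφ := hiso.valueSpan_eq
  have hψ := hcπ.valueSpan_le
  rw [valueSpan_const_mul, valueSpan_sumElim, valueSpan_const_mul] at hφ
  rw [valueSpan_const_mul] at hψ
  simp only [Fintype.card_fin, Fintype.card_sum, Fintype.card_pi, Finset.prod_const,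
    Finset.card_univ] at hcard
  have hA := hφan.finrank_valueSpan
  rw [hφ, finrank_smul he, Fintype.card_fin, hcard] at hA
  have hci := inv_ne_zero hc
  have hsmul : ∀ (d : F), d ≠ 0 → ∀ (a : F) (X : Submodule (pthSubfield 2 F) F),
      Module.finrank (pthSubfield 2 F) ↥(d • X ⊔ a • d • X) =
        Module.finrank (pthSubfield 2 F) ↥(X ⊔ a • X) := by
    intro d hd a X
    rw [smul_comm a d, ← Submodule.smul_sup', finrank_smul hd]
  obtain ⟨d, hd0, hd⟩ := exists_eq_smul_sup_smul πc b σ hσπ hσ (W := c⁻¹ • valueSpan ψ)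
    (fun x hx => by
      rw [mem_smul_iff hci, inv_inv]
      exact hψ (Submodule.smul_mem_pointwise_smul x c _ hx))
    hA (by
      rw [finrank_smul hci, hψan.finrank_valueSpan, hA, ← hcard, ← h.1, Fintype.card_fin])
    fun a => by
      rw [hsmul _ hci, ← h.finrank_sup_smul_eq, hφ, hsmul _ he]
  refine similar_of_valueSpan_eq hφan h.1
    (mul_ne_zero he (mul_ne_zero (inv_ne_zero hd0) hci)) ?_
  rw [hφ, mul_smul, mul_smul, hd, inv_smul_smul₀ hd0]

end Special

end QLF


/-- Characteristic 2. Let `φ ∼ᵥ₀ ψ` be anisotropic totally singular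
quadratic forms, `φ` a special quasi-Pfister neighbor given by the triple `(π, b, σ)`
(i.e. `φ` is similar to `π ⊥ bσ` with `π` quasi-Pfister and `σ ⊆ π`), and `cπ ⊆ ψ` for
some `c ∈ F×`. If `σ` is a quasi-Pfister form, a quasi-Pfister neighbor of codimension
one, or a minimal form, then `φ` and `ψ` are similar. -/
theorem stmt_5 {F : Type u} [Field F] [CharP F 2]
    {n m r s : ℕ} (φ : Fin n → F) (ψ : Fin m → F)
    (hφan : QLF.Anisotropic 2 φ) (hψan : QLF.Anisotropic 2 ψ)
    (h : QLF.WeakVishikEquiv 2 φ ψ)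
    (πc : Fin r → F) (hπc : ∀ i, πc i ≠ 0) (b : F) (hb : b ≠ 0)
    (σ : Fin s → F) (hσπ : QLF.Subform 2 σ (QLF.pfister 2 πc))
    (hspn : QLF.Similar 2 φ (Sum.elim (QLF.pfister 2 πc) fun j => b * σ j))
    (c : F) (hc : c ≠ 0)
    (hcπ : QLF.Subform 2 (fun e => c * QLF.pfister 2 πc e) ψ)
    (hσ : QLF.IsQuasiPfister 2 σ ∨ QLF.IsQPNeighborCodimOne 2 σ ∨ QLF.Minimal 2 σ) :
    QLF.Similar 2 φ ψ := by
  exact h.similar_of_special hφan hψan hσπ hspn hc hcπ hσ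
end

section
/- Let F be a field of characteristic 2 and let φ, ψ be totally singular quadratic forms over F that are Vishik equivalent. Let K/F be a field extension such that the set of squares {y² : y ∈ K} equals the image of G_F(φ) under the embedding F → K. Assume that the anisotropic part (φ_K)_an is a special quasi-Pfister neighbor over K given by a triple (π, b, σ), that cπ ⊆ ψ_K for some c ∈ K×, and that σ is either a quasi-Pfister form over K, a quasi-Pfister neighbor of codimension one of some anisotropic quasi-Pfister form over K, or a minimal form over K. Then φ and ψ are similar over F. -/
/-!
Diagonal quasilinear `p`-forms over a field `F` of characteristic `p`,
following Hoffmann and Zemková. A form of dimension `n` is recorded by its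
coefficient tuple `a : ι → F` (for a finite index type `ι`), the form being
`x ↦ ∑ i, a i * (x i)^p`.
-/

universe u

namespace SquareClosed

open Module Pointwise

variable {k K : Type*} [Field k] [Field K] [Algebra k K]

instance finite_mul (S T : Submodule k K) [FiniteDimensional k S] [FiniteDimensional k T] :
    FiniteDimensional k ↥(S * T) :=
  Module.Finite.iff_fg.2 ((Module.Finite.iff_fg.1 ‹_›).mul (Module.Finite.iff_fg.1 ‹_›))

instance finite_smul (x : K) (S : Submodule k K) [FiniteDimensional k S] :
    FiniteDimensional k ↥(x • S) :=
  Module.Finite.iff_fg.2 ((Module.Finite.iff_fg.1 ‹_›).map _)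

theorem finrank_smul {x : K} (hx : x ≠ 0) (S : Submodule k K) :
    finrank k ↥(x • S) = finrank k S := by
  have e := Submodule.equivMapOfInjective (DistribSMul.toLinearMap k K x)
    (fun a b h => mul_left_cancel₀ hx h) S
  exact e.finrank_eq.symm

theorem mul_eq_self_of_le {M N : Subalgebra k K} (h : M ≤ N) :
    Subalgebra.toSubmodule M * Subalgebra.toSubmodule N = Subalgebra.toSubmodule N := by
  apply le_antisymm
  · exact (mul_le_mul_left (show Subalgebra.toSubmodule M ≤ Subalgebra.toSubmodule N from h)
      _).trans (Subalgebra.mul_toSubmodule_le N N |>.trans (by simp))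
  · intro x hx
    rw [← one_mul x]
    exact Submodule.mul_mem_mul M.one_mem hx

theorem le_mul_left (M : Subalgebra k K) (S : Submodule k K) :
    S ≤ Subalgebra.toSubmodule M * S := fun x hx => by
  rw [← one_mul x]
  exact Submodule.mul_mem_mul M.one_mem hx

theorem le_mul_of_one_mem (M : Subalgebra k K) {S : Submodule k K} (h : (1 : K) ∈ S) :
    Subalgebra.toSubmodule M ≤ Subalgebra.toSubmodule M * S := fun x hx => by
  rw [← mul_one x]
  exact Submodule.mul_mem_mul hx h

/-- The square of every element of `K` lies in `k`. -/
def SqMem (k K : Type*) [Field k] [Field K] [Algebra k K] : Prop :=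
  ∀ x : K, ∃ a : k, algebraMap k K a = x ^ 2

theorem SqMem.mem (h : SqMem k K) (A : Subalgebra k K) (x : K) : x * x ∈ A := by
  obtain ⟨a, ha⟩ := h x
  rw [← pow_two, ← ha]
  exact A.algebraMap_mem a

theorem SqMem.inv_mem (h : SqMem k K) (A : Subalgebra k K) {x : K} (hx : x ∈ A) : x⁻¹ ∈ A := by
  rcases eq_or_ne x 0 with rfl | h0
  · simp
  obtain ⟨a, ha⟩ := h x
  have : x⁻¹ = a⁻¹ • x := by
    rw [Algebra.smul_def, map_inv₀, ha]
    field_simp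
  rw [this]
  exact A.smul_mem hx _

theorem SqMem.div_mem (h : SqMem k K) (A : Subalgebra k K) {x y : K} (hx : x ∈ A) (hy : y ∈ A) :
    x / y ∈ A := by
  rw [div_eq_mul_inv]
  exact A.mul_mem hx (h.inv_mem A hy)

/-- The subalgebra `A + A b`. -/
def quadExt (h : SqMem k K) (A : Subalgebra k K) (b : K) : Subalgebra k K where
  carrier := {x | ∃ p ∈ A, ∃ q ∈ A, x = p + q * b}
  mul_mem' := by
    rintro _ _ ⟨p, hp, q, hq, rfl⟩ ⟨p', hp', q', hq', rfl⟩
    refine ⟨p * p' + q * q' * (b * b), ?_, p * q' + q * p', ?_, by ring⟩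
    · exact A.add_mem (A.mul_mem hp hp') (A.mul_mem (A.mul_mem hq hq') (h.mem A b))
    · exact A.add_mem (A.mul_mem hp hq') (A.mul_mem hq hp')
  add_mem' := by
    rintro _ _ ⟨p, hp, q, hq, rfl⟩ ⟨p', hp', q', hq', rfl⟩
    exact ⟨p + p', A.add_mem hp hp', q + q', A.add_mem hq hq', by ring⟩
  algebraMap_mem' r := ⟨_, A.algebraMap_mem r, 0, A.zero_mem, by ring⟩

theorem mem_quadExt {h : SqMem k K} {A : Subalgebra k K} {b x : K} :
    x ∈ quadExt h A b ↔ ∃ p ∈ A, ∃ q ∈ A, x = p + q * b := Iff.rfl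

theorem le_quadExt (h : SqMem k K) (A : Subalgebra k K) (b : K) : A ≤ quadExt h A b :=
  fun x hx => ⟨x, hx, 0, A.zero_mem, by ring⟩

theorem self_mem_quadExt (h : SqMem k K) (A : Subalgebra k K) (b : K) : b ∈ quadExt h A b :=
  ⟨0, A.zero_mem, 1, A.one_mem, by ring⟩

theorem toSubmodule_quadExt (h : SqMem k K) (A : Subalgebra k K) (b : K) :
    Subalgebra.toSubmodule (quadExt h A b) =
      Subalgebra.toSubmodule A ⊔ b • Subalgebra.toSubmodule A := by
  ext x
  simp only [Subalgebra.mem_toSubmodule, mem_quadExt, Submodule.mem_sup,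
    Submodule.mem_smul_pointwise_iff_exists, smul_eq_mul]
  constructor
  · rintro ⟨p, hp, q, hq, rfl⟩
    exact ⟨p, hp, b * q, ⟨q, hq, rfl⟩, by ring⟩
  · rintro ⟨p, hp, _, ⟨q, hq, rfl⟩, rfl⟩
    exact ⟨p, hp, q, hq, by ring⟩

theorem quadExt_le (h : SqMem k K) {A B : Subalgebra k K} {b : K} (hA : A ≤ B) (hb : b ∈ B) :
    quadExt h A b ≤ B := by
  rintro _ ⟨p, hp, q, hq, rfl⟩
  exact B.add_mem (hA hp) (B.mul_mem (hA hq) hb)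

instance finite_quadExt (h : SqMem k K) (A : Subalgebra k K) (b : K)
    [FiniteDimensional k (Subalgebra.toSubmodule A)] :
    FiniteDimensional k (Subalgebra.toSubmodule (quadExt h A b)) := by
  rw [toSubmodule_quadExt]
  infer_instance

theorem finrank_quadExt_le (h : SqMem k K) (A : Subalgebra k K) (b : K)
    [FiniteDimensional k (Subalgebra.toSubmodule A)] :
    finrank k (Subalgebra.toSubmodule (quadExt h A b)) ≤
      2 * finrank k (Subalgebra.toSubmodule A) := by
  rw [toSubmodule_quadExt, two_mul]
  exact (Submodule.finrank_add_le_finrank_add_finrank _ _).trans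
    (Nat.add_le_add_left (Submodule.finrank_map_le (DistribSMul.toLinearMap k K b) _) _)

/-- `1, b` are independent over `A` when `b ∉ A`. -/
theorem coeff_eq_zero (h : SqMem k K) {A : Subalgebra k K} {b p q : K} (hb : b ∉ A)
    (hp : p ∈ A) (hq : q ∈ A) (hpq : p + q * b = 0) : p = 0 ∧ q = 0 := by
  have hq0 : q = 0 := by
    by_contra hq0
    apply hb
    have : b = -(p / q) := by field_simp; linear_combination hpq
    rw [this]
    exact A.neg_mem (h.div_mem A hp hq)
  subst hq0
  simpa using hpq

/-- `S` and `T` span spaces of the same dimension over every subalgebra of `P`. -/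
def SameDim (P : Subalgebra k K) (S T : Submodule k K) : Prop :=
  ∀ M : Subalgebra k K, M ≤ P →
    finrank k ↥(Subalgebra.toSubmodule M * S) = finrank k ↥(Subalgebra.toSubmodule M * T)

theorem SameDim.mono {P Q : Subalgebra k K} {S T : Submodule k K} (h : SameDim P S T)
    (hQ : Q ≤ P) : SameDim Q S T := fun M hM => h M (hM.trans hQ)

theorem SameDim.symm {P : Subalgebra k K} {S T : Submodule k K} (h : SameDim P S T) :
    SameDim P T S := fun M hM => (h M hM).symm

theorem SameDim.smul_right {P : Subalgebra k K} {S T : Submodule k K} (h : SameDim P S T)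
    {x : K} (hx : x ≠ 0) : SameDim P S (x • T) := fun M hM => by
  rw [mul_smul_comm, finrank_smul hx, h M hM]

theorem SameDim.smul_left {P : Subalgebra k K} {S T : Submodule k K} (h : SameDim P S T)
    {x : K} (hx : x ≠ 0) : SameDim P (x • S) T := (h.symm.smul_right hx).symm

theorem SameDim.finrank_eq {P : Subalgebra k K} {S T : Submodule k K} (h : SameDim P S T) :
    finrank k S = finrank k T := by
  have := h ⊥ bot_le
  rwa [Algebra.toSubmodule_bot, one_mul, one_mul] at this

/-- If `M * T` has the dimension of `M` then `T` lies in a multiple of `M`. -/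
theorem le_smul_of_finrank_eq {M : Subalgebra k K} {T : Submodule k K}
    [FiniteDimensional k (Subalgebra.toSubmodule M)] [FiniteDimensional k T]
    (h : finrank k ↥(Subalgebra.toSubmodule M * T) = finrank k (Subalgebra.toSubmodule M))
    {t : K} (ht : t ∈ T) (h0 : t ≠ 0) : T ≤ t • Subalgebra.toSubmodule M := by
  have h1 : t • Subalgebra.toSubmodule M ≤ Subalgebra.toSubmodule M * T := by
    rintro _ ⟨m, hm, rfl⟩
    simpa [mul_comm] using Submodule.mul_mem_mul hm ht
  have := Submodule.eq_of_le_of_finrank_eq h1 (by rw [finrank_smul h0, h])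
  rw [this]
  exact le_mul_left M T

theorem finiteDimensional_of_le {M P : Subalgebra k K}
    [FiniteDimensional k (Subalgebra.toSubmodule P)] (h : M ≤ P) :
    FiniteDimensional k (Subalgebra.toSubmodule M) :=
  Submodule.finiteDimensional_of_le (show Subalgebra.toSubmodule M ≤ Subalgebra.toSubmodule P from h)

theorem exists_smul_of_eq_subalgebra {P M : Subalgebra k K} {S T : Submodule k K}
    [FiniteDimensional k S] [FiniteDimensional k T] (hH : SameDim P S T) (hM : M ≤ P)
    (hS : S = Subalgebra.toSubmodule M) : ∃ t : K, t ≠ 0 ∧ T = t • S := by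
  subst hS
  have hr := hH.finrank_eq
  have hT : T ≠ ⊥ := by
    rintro rfl
    rw [finrank_bot] at hr
    have := Submodule.finrank_eq_zero.1 hr
    have h1 : (1 : K) ∈ Subalgebra.toSubmodule M := M.one_mem
    rw [this] at h1
    exact one_ne_zero ((Submodule.mem_bot k).1 h1)
  obtain ⟨t, ht, h0⟩ := Submodule.exists_mem_ne_zero_of_ne_bot hT
  refine ⟨t, h0, Submodule.eq_of_le_of_finrank_eq (le_smul_of_finrank_eq ?_ ht h0) ?_⟩
  · rw [← hH M hM, mul_eq_self_of_le le_rfl]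
  · rw [finrank_smul h0, hr]

theorem exists_smul_of_finrank_eq_one {S T : Submodule k K} (hS : finrank k S = 1)
    (hT : finrank k T = 1) : ∃ t : K, t ≠ 0 ∧ T = t • S := by
  have : FiniteDimensional k S := FiniteDimensional.of_finrank_pos (by omega)
  have : FiniteDimensional k T := FiniteDimensional.of_finrank_pos (by omega)
  obtain ⟨s, hs, hs0⟩ := Submodule.exists_mem_ne_zero_of_ne_bot
    (p := S) (by rintro rfl; simp at hS)
  obtain ⟨t, ht, ht0⟩ := Submodule.exists_mem_ne_zero_of_ne_bot
    (p := T) (by rintro rfl; simp at hT)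
  have hts : t / s ≠ 0 := div_ne_zero ht0 hs0
  refine ⟨t / s, hts, ?_⟩
  have h1 : Submodule.span k {t} = T := Submodule.eq_of_le_of_finrank_eq (by simpa using ht)
    (by rw [hT, finrank_span_singleton ht0])
  have h2 : Submodule.span k {t} = (t / s) • S := by
    refine Submodule.eq_of_le_of_finrank_eq ?_
      (by rw [finrank_smul hts, hS, finrank_span_singleton ht0])
    rw [Submodule.span_singleton_le_iff_mem]
    exact ⟨s, hs, div_mul_cancel₀ t hs0⟩
  rw [← h1, h2]

/-- Any two hyperplanes of `M` differ by a factor. -/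
theorem exists_smul_eq_of_hyperplanes {M : Subalgebra k K}
    [FiniteDimensional k (Subalgebra.toSubmodule M)] {S T : Submodule k K}
    (hS : S ≤ Subalgebra.toSubmodule M) (hT : T ≤ Subalgebra.toSubmodule M)
    (hSM : finrank k S + 1 = finrank k (Subalgebra.toSubmodule M))
    (hTM : finrank k T + 1 = finrank k (Subalgebra.toSubmodule M)) :
    ∃ m : K, m ≠ 0 ∧ S = m • T := by
  have : FiniteDimensional k S := Submodule.finiteDimensional_of_le hS
  have : FiniteDimensional k T := Submodule.finiteDimensional_of_le hT
  have hlt : S < Subalgebra.toSubmodule M := lt_of_le_of_ne hS (by rintro h; rw [h] at hSM; omega)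
  obtain ⟨m₀, hm₀, hm₀S⟩ := SetLike.exists_of_lt hlt
  obtain ⟨l, hl, hlS⟩ := Submodule.exists_le_ker_of_notMem hm₀S
  let Φ : Subalgebra.toSubmodule M →ₗ[k] Dual k T :=
    ((LinearMap.mul k K).compr₂ l).domRestrict₁₂ (Subalgebra.toSubmodule M) T
  obtain ⟨m, hm, hm0⟩ := Submodule.exists_mem_ne_zero_of_ne_bot
    (LinearMap.ker_ne_bot_of_finrank_lt (f := Φ) (by rw [Subspace.dual_finrank_eq]; omega))
  have hm0' : (m : K) ≠ 0 := by simpa using hm0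
  have hSl : S = Subalgebra.toSubmodule M ⊓ LinearMap.ker l := by
    refine Submodule.eq_of_le_of_finrank_le (le_inf hS hlS) ?_
    have : Subalgebra.toSubmodule M ⊓ LinearMap.ker l < Subalgebra.toSubmodule M :=
      lt_of_le_of_ne inf_le_left fun h => hl (LinearMap.mem_ker.1 (inf_eq_left.1 h hm₀))
    have := Submodule.finrank_lt_finrank_of_lt this
    omega
  refine ⟨m, hm0', (Submodule.eq_of_le_of_finrank_eq ?_ ?_).symm⟩
  · rw [hSl]
    rintro _ ⟨t, ht, rfl⟩
    refine ⟨M.mul_mem m.2 (hT ht), ?_⟩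
    exact LinearMap.congr_fun (LinearMap.mem_ker.1 hm) ⟨t, ht⟩
  · rw [finrank_smul hm0']
    omega

theorem exists_smul_of_codim_one (h : SqMem k K) {P M : Subalgebra k K}
    [FiniteDimensional k (Subalgebra.toSubmodule M)] {S T : Submodule k K}
    [FiniteDimensional k S] [FiniteDimensional k T] (hSP : S ≤ Subalgebra.toSubmodule P)
    (hH : SameDim P S T) {e : K} (he : e ≠ 0) (heS : e • S ≤ Subalgebra.toSubmodule M)
    (hdim : finrank k S + 1 = finrank k (Subalgebra.toSubmodule M)) (hS : S ≠ ⊥) :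
    ∃ t : K, t ≠ 0 ∧ T = t • S := by
  have hST := hH.finrank_eq
  have hpos : finrank k S ≠ 0 := fun h0 => hS (Submodule.finrank_eq_zero.1 h0)
  by_cases h1 : finrank k S = 1
  · exact exists_smul_of_finrank_eq_one h1 (hST ▸ h1)
  have hMP : M ≤ P := by
    intro m hm
    rcases eq_or_ne m 0 with rfl | hm0
    · exact P.zero_mem
    have hle : e • S ⊔ m • e • S ≤ Subalgebra.toSubmodule M := by
      refine sup_le heS ?_
      rintro _ ⟨x, hx, rfl⟩
      exact M.mul_mem hm (heS hx)
    have hr := Submodule.finrank_mono hle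
    have hsum := Submodule.finrank_sup_add_finrank_inf_eq (e • S) (m • e • S)
    rw [finrank_smul hm0, finrank_smul he] at hsum
    obtain ⟨x, ⟨⟨s, hs, hx⟩, ⟨_, ⟨s', hs', rfl⟩, hx'⟩⟩, hx0⟩ :=
      Submodule.exists_mem_ne_zero_of_ne_bot (p := e • S ⊓ m • e • S)
        (fun h0 => by rw [h0, finrank_bot] at hsum; omega)
    simp only [DistribSMul.toLinearMap_apply, smul_eq_mul] at hx hx'
    have hs'0 : s' ≠ 0 := by rintro rfl; apply hx0; rw [← hx']; ring
    have : m = s / s' := by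
      rw [eq_div_iff hs'0]
      apply mul_left_cancel₀ he
      rw [hx, ← hx']; ring
    rw [this]
    exact h.div_mem P (hSP hs) (hSP hs')
  have hT : T ≠ ⊥ := by
    rintro rfl
    rw [finrank_bot] at hST
    exact hpos hST
  obtain ⟨t, ht, ht0⟩ := Submodule.exists_mem_ne_zero_of_ne_bot hT
  obtain ⟨s, hs, hs0⟩ := Submodule.exists_mem_ne_zero_of_ne_bot hS
  have hTM : T ≤ t • Subalgebra.toSubmodule M := by
    refine le_smul_of_finrank_eq ?_ ht ht0
    rw [← (hH.smul_left he) M hMP]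
    apply le_antisymm
    · refine Submodule.finrank_mono ?_
      exact (mul_le_mul_right heS _).trans (mul_eq_self_of_le le_rfl).le
    · have hes : e * s ≠ 0 := mul_ne_zero he hs0
      rw [← finrank_smul hes]
      refine Submodule.finrank_mono ?_
      rintro _ ⟨m, hm, rfl⟩
      have : e * s ∈ e • S := ⟨s, hs, rfl⟩
      simpa [mul_comm] using Submodule.mul_mem_mul hm this
  have ht' : t⁻¹ ≠ 0 := inv_ne_zero ht0
  have hTM' : t⁻¹ • T ≤ Subalgebra.toSubmodule M := by
    rintro _ ⟨x, hx, rfl⟩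
    exact (Submodule.mem_smul_iff_inv_mul_mem ht0).1 (hTM hx)
  obtain ⟨m, hm, hmT⟩ := exists_smul_eq_of_hyperplanes hTM' heS
    (by rw [finrank_smul ht']; omega) (by rw [finrank_smul he]; omega)
  refine ⟨t * (m * e), by positivity, ?_⟩
  rw [mul_smul, mul_smul, ← hmT, smul_inv_smul₀ ht0]

theorem finrank_sup_span_singleton {U : Submodule k K} [FiniteDimensional k U] {x : K}
    (hx : x ∉ U) : finrank k ↥(U ⊔ Submodule.span k {x}) = finrank k U + 1 := by
  have h0 : x ≠ 0 := fun h => hx (h ▸ U.zero_mem)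
  have h1 := Submodule.finrank_add_le_finrank_add_finrank U (Submodule.span k {x})
  rw [finrank_span_singleton h0] at h1
  have h2 : U < U ⊔ Submodule.span k {x} := left_lt_sup.2 (by simpa using hx)
  have := Submodule.finrank_lt_finrank_of_lt h2
  omega

theorem mul_mem_of_mem_bot {S : Submodule k K} {a x : K} (ha : a ∈ (⊥ : Subalgebra k K))
    (hx : x ∈ S) : a * x ∈ S := by
  obtain ⟨r, rfl⟩ := Algebra.mem_bot.1 ha
  rw [← Algebra.smul_def]
  exact S.smul_mem r hx

theorem mem_sup_span_singleton {U : Submodule k K} {v x : K} :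
    x ∈ U ⊔ Submodule.span k {v} ↔ ∃ u ∈ U, ∃ a ∈ (⊥ : Subalgebra k K), x = u + a * v := by
  simp only [Submodule.mem_sup, Submodule.mem_span_singleton, Algebra.mem_bot, Set.mem_range]
  constructor
  · rintro ⟨u, hu, _, ⟨r, rfl⟩, rfl⟩
    exact ⟨u, hu, _, ⟨r, rfl⟩, by rw [Algebra.smul_def]⟩
  · rintro ⟨u, hu, _, ⟨r, rfl⟩, rfl⟩
    exact ⟨u, hu, _, ⟨r, rfl⟩, by rw [Algebra.smul_def]⟩

/-- The dimension of the subalgebra generated by a subspace. -/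
noncomputable def genDim (S : Submodule k K) : ℕ :=
  finrank k (Subalgebra.toSubmodule (Algebra.adjoin k (S : Set K)))

theorem toSubmodule_adjoin_le {U : Submodule k K} {A : Subalgebra k K}
    (h : U ≤ Subalgebra.toSubmodule A) :
    Subalgebra.toSubmodule (Algebra.adjoin k (U : Set K)) ≤ Subalgebra.toSubmodule A :=
  Algebra.adjoin_le (S := A) h

theorem finite_adjoin {P : Subalgebra k K} [FiniteDimensional k (Subalgebra.toSubmodule P)]
    {S : Submodule k K} (hS : S ≤ Subalgebra.toSubmodule P) :
    FiniteDimensional k (Subalgebra.toSubmodule (Algebra.adjoin k (S : Set K))) :=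
  finiteDimensional_of_le (Algebra.adjoin_le hS)

theorem genDim_le (h : SqMem k K) {P : Subalgebra k K}
    [FiniteDimensional k (Subalgebra.toSubmodule P)] {T : Submodule k K}
    (hT : T ≤ Subalgebra.toSubmodule P) {U : Submodule k K} (hU : U ≤ T) :
    genDim T ≤ genDim U * 2 ^ (finrank k T - finrank k U) := by
  have : FiniteDimensional k T := Submodule.finiteDimensional_of_le hT
  induction hd : finrank k T - finrank k U generalizing U with
  | zero =>
    have := Submodule.eq_of_le_of_finrank_le hU (by omega)
    simp [this]
  | succ d ih =>
    have hne : U < T := lt_of_le_of_ne hU (by rintro rfl; omega)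
    obtain ⟨x, hxT, hxU⟩ := SetLike.exists_of_lt hne
    have hU' : U ⊔ Submodule.span k {x} ≤ T :=
      sup_le hU (by simpa using hxT)
    have hr : finrank k ↥(U ⊔ Submodule.span k {x}) = finrank k U + 1 := by
      have : FiniteDimensional k U := Submodule.finiteDimensional_of_le hU
      exact finrank_sup_span_singleton hxU
    have := ih hU' (by omega)
    refine this.trans ?_
    rw [pow_succ', ← mul_assoc]
    refine Nat.mul_le_mul_right _ ?_
    have := finite_adjoin (hU.trans hT)
    rw [mul_comm]
    refine le_trans ?_ (finrank_quadExt_le h (Algebra.adjoin k (U : Set K)) x)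
    refine Submodule.finrank_mono (toSubmodule_adjoin_le ?_)
    refine sup_le ?_ ?_
    · intro u hu
      exact le_quadExt h _ x (Algebra.subset_adjoin hu)
    · rw [Submodule.span_singleton_le_iff_mem]
      exact self_mem_quadExt h _ x

/-- A subspace containing `1` is minimal if it generates a subalgebra of largest
possible dimension. -/
def IsMin (S : Submodule k K) : Prop :=
  (1 : K) ∈ S ∧ 2 ^ (finrank k S - 1) ≤ genDim S

theorem IsMin.mem_of_mem_adjoin (h : SqMem k K) {P : Subalgebra k K}
    [FiniteDimensional k (Subalgebra.toSubmodule P)] {T : Submodule k K} (hm : IsMin T)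
    (hT : T ≤ Subalgebra.toSubmodule P) {U : Submodule k K} (hU : U ≤ T) (h1 : (1 : K) ∈ U)
    {x : K} (hx : x ∈ T) (hxU : x ∈ Algebra.adjoin k (U : Set K)) : x ∈ U := by
  by_contra hn
  have : FiniteDimensional k T := Submodule.finiteDimensional_of_le hT
  have : FiniteDimensional k U := Submodule.finiteDimensional_of_le hU
  have hU' : U ⊔ Submodule.span k {x} ≤ T := sup_le hU (by simpa using hx)
  have hr : finrank k ↥(U ⊔ Submodule.span k {x}) = finrank k U + 1 :=
    finrank_sup_span_singleton hn
  have hle := Submodule.finrank_mono hU'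
  have hgen : genDim (U ⊔ Submodule.span k {x}) ≤ genDim U := by
    have := finite_adjoin (hU.trans hT)
    refine Submodule.finrank_mono (toSubmodule_adjoin_le ?_)
    exact sup_le (fun u hu => Algebra.subset_adjoin hu) (by simpa using hxU)
  have h3 := genDim_le h hT hU'
  have hone : Submodule.span k {(1 : K)} ≤ U := by simpa using h1
  have h4 := genDim_le h (hU.trans hT) hone
  have h5 : genDim (Submodule.span k {(1 : K)}) ≤ 1 := by
    rw [← finrank_span_singleton (K := k) (one_ne_zero (α := K))]
    refine Submodule.finrank_mono ?_
    rw [← Submodule.one_eq_span, ← Algebra.toSubmodule_bot]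
    exact toSubmodule_adjoin_le le_rfl
  rw [finrank_span_singleton one_ne_zero] at h4
  have h6 : 0 < finrank k U := by
    have := Submodule.finrank_mono hone
    rw [finrank_span_singleton one_ne_zero] at this
    omega
  have h7 := hm.2
  obtain ⟨a, ha⟩ := Nat.exists_eq_add_of_lt h6
  obtain ⟨c, hc⟩ := Nat.exists_eq_add_of_le hle
  rw [hr] at hc h3
  rw [show finrank k T - (finrank k U + 1) = c by omega] at h3
  rw [show finrank k T - 1 = a + c + 1 by omega] at h7
  rw [show finrank k U - 1 = a by omega] at h4
  have h8 : genDim T ≤ 2 ^ a * 2 ^ c := by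
    refine h3.trans (Nat.mul_le_mul_right _ (hgen.trans (h4.trans ?_)))
    simpa using Nat.mul_le_mul_right (2 ^ a) h5
  have : 0 < 2 ^ a * 2 ^ c := by positivity
  rw [pow_succ, pow_add] at h7
  omega

theorem exists_mul_mem (h : SqMem k K) {P : Subalgebra k K} {S T : Submodule k K}
    [FiniteDimensional k S] [FiniteDimensional k T] (hH : SameDim P S T) {x s : K} (hx : x ∈ P)
    (hs : s ∈ S) (hs0 : s ≠ 0) (hxs : x * s ∈ S) : ∃ t ∈ T, t ≠ 0 ∧ x * t ∈ T := by
  have hST := hH.finrank_eq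
  rcases eq_or_ne x 0 with rfl | hx0
  · have hT : T ≠ ⊥ := by
      rintro rfl
      rw [finrank_bot] at hST
      rw [Submodule.finrank_eq_zero.1 hST] at hs
      exact hs0 ((Submodule.mem_bot k).1 hs)
    obtain ⟨t, ht, ht0⟩ := Submodule.exists_mem_ne_zero_of_ne_bot hT
    exact ⟨t, ht, ht0, by simp⟩
  have key (R : Submodule k K) :
      Subalgebra.toSubmodule (quadExt h ⊥ x) * R = R ⊔ x • R := by
    rw [toSubmodule_quadExt, Algebra.toSubmodule_bot, Submodule.sup_mul, one_mul,
      smul_mul_assoc, one_mul]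
  have hL := hH (quadExt h ⊥ x) (quadExt_le h bot_le hx)
  rw [key, key] at hL
  have e1 := Submodule.finrank_sup_add_finrank_inf_eq S (x • S)
  have e2 := Submodule.finrank_sup_add_finrank_inf_eq T (x • T)
  rw [finrank_smul hx0] at e1 e2
  have hne : finrank k ↥(S ⊓ x • S) ≠ 0 := by
    intro h0
    have hmem : x * s ∈ S ⊓ x • S := ⟨hxs, ⟨s, hs, rfl⟩⟩
    rw [Submodule.finrank_eq_zero.1 h0] at hmem
    exact mul_ne_zero hx0 hs0 ((Submodule.mem_bot k).1 hmem)
  obtain ⟨_, ⟨hy, ⟨t, ht, rfl⟩⟩, hy0⟩ := Submodule.exists_mem_ne_zero_of_ne_bot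
    (p := T ⊓ x • T) (fun h0 => by rw [h0, finrank_bot] at e2; omega)
  exact ⟨t, ht, by rintro rfl; simp at hy0, hy⟩

theorem SameDim.le_subalgebra {M : Subalgebra k K}
    [FiniteDimensional k (Subalgebra.toSubmodule M)] {S T : Submodule k K}
    [FiniteDimensional k T] (hH : SameDim M S T) (hS : S ≤ Subalgebra.toSubmodule M)
    (hS1 : (1 : K) ∈ S) (hT1 : (1 : K) ∈ T) : T ≤ Subalgebra.toSubmodule M := by
  have := le_smul_of_finrank_eq (M := M) (T := T) ?_ hT1 one_ne_zero
  · simpa using this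
  · rw [← hH M le_rfl, le_antisymm ((mul_le_mul_right hS _).trans (mul_eq_self_of_le le_rfl).le)
      (le_mul_of_one_mem M hS1)]

theorem IsMin.of_sameDim {P : Subalgebra k K}
    [FiniteDimensional k (Subalgebra.toSubmodule P)] {S T : Submodule k K}
    [FiniteDimensional k T] (hm : IsMin S)
    (hS : S ≤ Subalgebra.toSubmodule P) (hH : SameDim P S T) (h1 : (1 : K) ∈ T) :
    T ≤ Subalgebra.toSubmodule P ∧ IsMin T := by
  have : FiniteDimensional k S := Submodule.finiteDimensional_of_le hS
  have hN : Algebra.adjoin k (S : Set K) ≤ P := Algebra.adjoin_le hS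
  have := finite_adjoin hS
  have hTN := (hH.mono hN).le_subalgebra (fun x hx => Algebra.subset_adjoin hx) hm.1 h1
  have hTP : T ≤ Subalgebra.toSubmodule P := hTN.trans hN
  refine ⟨hTP, h1, ?_⟩
  have hN' : Algebra.adjoin k (T : Set K) ≤ P := Algebra.adjoin_le hTP
  have := finite_adjoin hTP
  have hSN' := (hH.symm.mono hN').le_subalgebra (fun x hx => Algebra.subset_adjoin hx) h1 hm.1
  rw [← hH.finrank_eq]
  refine hm.2.trans ?_
  exact Submodule.finrank_mono (toSubmodule_adjoin_le hSN')

theorem mem_inv_smul_iff {T : Submodule k K} {u x : K} (hu : u ≠ 0) :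
    x ∈ u⁻¹ • T ↔ u * x ∈ T := by
  rw [Submodule.mem_smul_iff_inv_mul_mem (inv_ne_zero hu), inv_inv]

theorem IsMin.exists_common (h : SqMem k K) {P : Subalgebra k K}
    [FiniteDimensional k (Subalgebra.toSubmodule P)] {T : Submodule k K} (hm : IsMin T)
    (hT : T ≤ Subalgebra.toSubmodule P) {x y v w : K} (hx : x ∈ T) (hv : v ∈ T)
    (hvy : v * y ∈ T) (hw : w ∈ T) (hwxy : w * (x * y) ∈ T) (hx0 : x ∉ (⊥ : Subalgebra k K))
    (hy0 : y ∉ (⊥ : Subalgebra k K)) (hv0 : v ≠ 0) (hw0 : w ≠ 0) :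
    ∃ a ∈ (⊥ : Subalgebra k K), ∃ b ∈ (⊥ : Subalgebra k K), ∃ c ∈ (⊥ : Subalgebra k K),
      ∃ d ∈ (⊥ : Subalgebra k K), a + b * x ≠ 0 ∧ a + b * x = v * (c + d * y) := by
  by_contra hcon
  have hind {a b c d : K} (ha : a ∈ (⊥ : Subalgebra k K)) (hb : b ∈ (⊥ : Subalgebra k K))
      (hc : c ∈ (⊥ : Subalgebra k K)) (hd : d ∈ (⊥ : Subalgebra k K))
      (he : a + b * x = v * (c + d * y)) : a + b * x = 0 := by
    by_contra hne
    exact hcon ⟨a, ha, b, hb, c, hc, d, hd, hne, he⟩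
  have hxne : x ≠ 0 := fun h0 => hx0 (h0 ▸ Subalgebra.zero_mem _)
  have hyne : y ≠ 0 := fun h0 => hy0 (h0 ▸ Subalgebra.zero_mem _)
  have h1 : (1 : K) ∈ T := hm.1
  set A := quadExt h ⊥ x with hA
  have hAT : Subalgebra.toSubmodule A ≤ T := by
    rintro _ ⟨a, ha, b, hb, rfl⟩
    exact T.add_mem (by simpa using mul_mem_of_mem_bot ha h1) (mul_mem_of_mem_bot hb hx)
  have hxA : x ∈ A := self_mem_quadExt h ⊥ x
  have hvA : v ∉ A := by
    rintro ⟨a, ha, b, hb, hab⟩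
    have := hind ha hb (one_mem _) (zero_mem _) (by rw [← hab]; ring)
    exact hv0 (hab.trans this)
  set U₂ := Subalgebra.toSubmodule A ⊔ Submodule.span k {v} with hU₂
  have hU₂T : U₂ ≤ T := sup_le hAT (by simpa using hv)
  have hvyU : v * y ∉ U₂ := by
    rw [hU₂, mem_sup_span_singleton]
    rintro ⟨_, ⟨a, ha, b, hb, rfl⟩, c, hc, he⟩
    have h0 := hind ha hb (neg_mem hc) (one_mem _) (by linear_combination -he)
    rw [h0, zero_add, mul_comm] at he
    exact hy0 (mul_right_cancel₀ hv0 he ▸ hc)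
  set B := quadExt h A v with hB
  have hAB : A ≤ B := le_quadExt h A v
  have hvB : v ∈ B := self_mem_quadExt h A v
  have hAU₂ : A ≤ Algebra.adjoin k (U₂ : Set K) := fun z hz =>
    Algebra.subset_adjoin (Submodule.mem_sup_left (S := Subalgebra.toSubmodule A) hz)
  have hvU₂ : v ∈ U₂ := Submodule.mem_sup_right (Submodule.mem_span_singleton_self v)
  have hBU₂ : B ≤ Algebra.adjoin k (U₂ : Set K) :=
    quadExt_le h hAU₂ (Algebra.subset_adjoin hvU₂)
  have h1U₂ : (1 : K) ∈ U₂ :=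
    Submodule.mem_sup_left (S := Subalgebra.toSubmodule A) A.one_mem
  have hyB : y ∉ B := fun hy =>
    hvyU (hm.mem_of_mem_adjoin h hT hU₂T h1U₂ hvy (hBU₂ (B.mul_mem hvB hy)))
  set U₃ := U₂ ⊔ Submodule.span k {v * y} with hU₃
  have hU₃T : U₃ ≤ T := sup_le hU₂T (by simpa using hvy)
  have h1U₃ : (1 : K) ∈ U₃ := Submodule.mem_sup_left h1U₂
  set D := Algebra.adjoin k (U₃ : Set K) with hD
  have hxD : x ∈ D := Algebra.subset_adjoin
    (Submodule.mem_sup_left (Submodule.mem_sup_left (S := Subalgebra.toSubmodule A) hxA))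
  have hyD : y ∈ D := by
    have e1 : v * y ∈ D := Algebra.subset_adjoin
      (Submodule.mem_sup_right (Submodule.mem_span_singleton_self _))
    have e2 : v ∈ D := Algebra.subset_adjoin (Submodule.mem_sup_left hvU₂)
    have := h.div_mem D e1 e2
    rwa [mul_div_cancel_left₀ y hv0] at this
  have hwU₃ : w ∈ U₃ := by
    by_contra hn
    have hwD : w ∉ D := fun hwD => hn (hm.mem_of_mem_adjoin h hT hU₃T h1U₃ hw hwD)
    have hU₄T : U₃ ⊔ Submodule.span k {w} ≤ T := sup_le hU₃T (by simpa using hw)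
    have hmem : w * (x * y) ∈ Algebra.adjoin k ((U₃ ⊔ Submodule.span k {w} : Submodule k K) : Set K) := by
      have hle : D ≤ Algebra.adjoin k ((U₃ ⊔ Submodule.span k {w} : Submodule k K) : Set K) :=
        Algebra.adjoin_mono (SetLike.coe_subset_coe.2 le_sup_left)
      refine mul_mem (Algebra.subset_adjoin ?_) (mul_mem (hle hxD) (hle hyD))
      exact Submodule.mem_sup_right (Submodule.mem_span_singleton_self w)
    have hmem' := hm.mem_of_mem_adjoin h hT hU₄T (Submodule.mem_sup_left h1U₃) hwxy hmem
    obtain ⟨u, hu, a, ha, he⟩ := mem_sup_span_singleton.1 hmem'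
    have hle : (⊥ : Subalgebra k K) ≤ D := bot_le
    by_cases hxya : x * y - a = 0
    · apply hyB
      have : y = a / x := by
        rw [eq_div_iff hxne]
        linear_combination hxya
      rw [this]
      exact h.div_mem B ((bot_le : ⊥ ≤ B) ha) (hAB hxA)
    · apply hwD
      have : w = u / (x * y - a) := by
        rw [eq_div_iff hxya]
        linear_combination he
      rw [this]
      exact h.div_mem D (Algebra.subset_adjoin hu)
        (D.sub_mem (D.mul_mem hxD hyD) (hle ha))
  have hwxyU₃ : w * (x * y) ∈ U₃ := hm.mem_of_mem_adjoin h hT hU₃T h1U₃ hwxy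
    (D.mul_mem (Algebra.subset_adjoin hwU₃) (D.mul_mem hxD hyD))
  obtain ⟨_, hu, d, hd, hw1⟩ := mem_sup_span_singleton.1 hwU₃
  obtain ⟨_, ⟨a, ha, b, hb, rfl⟩, c, hc, rfl⟩ := mem_sup_span_singleton.1 hu
  obtain ⟨_, hu', d', hd', hw2⟩ := mem_sup_span_singleton.1 hwxyU₃
  obtain ⟨_, ⟨a', ha', b', hb', rfl⟩, c', hc', rfl⟩ := mem_sup_span_singleton.1 hu'
  have bA : ∀ {z : K}, z ∈ (⊥ : Subalgebra k K) → z ∈ A := fun hz => (bot_le : ⊥ ≤ A) hz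
  have hyy : y * y ∈ (⊥ : Subalgebra k K) := h.mem ⊥ y
  have hp1 : -(a' + b' * x) ∈ A :=
    A.neg_mem (A.add_mem (bA ha') (A.mul_mem (bA hb') hxA))
  have hp2 : d * (y * y) * x - c' ∈ A :=
    A.sub_mem (A.mul_mem (A.mul_mem (bA hd) (bA hyy)) hxA) (bA hc')
  have hq1 : (a + b * x) * x ∈ A :=
    A.mul_mem (A.add_mem (bA ha) (A.mul_mem (bA hb) hxA)) hxA
  have hq2 : c * x - d' ∈ A := A.sub_mem (A.mul_mem (bA hc) hxA) (bA hd')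
  obtain ⟨hp, hq⟩ := coeff_eq_zero h hyB
    (p := -(a' + b' * x) + (d * (y * y) * x - c') * v)
    (q := (a + b * x) * x + (c * x - d') * v)
    (B.add_mem (hAB hp1) (B.mul_mem (hAB hp2) hvB))
    (B.add_mem (hAB hq1) (B.mul_mem (hAB hq2) hvB))
    (by rw [hw1] at hw2; linear_combination hw2)
  obtain ⟨-, hp⟩ := coeff_eq_zero h hvA hp1 hp2 hp
  obtain ⟨hq, hq'⟩ := coeff_eq_zero h hvA hq1 hq2 hq
  have hab : a + b * x = 0 := by simpa [hxne] using hq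
  obtain ⟨-, hc0⟩ := coeff_eq_zero h hx0 (p := -d') (q := c) (neg_mem hd') hc
    (by linear_combination hq')
  obtain ⟨-, hd0⟩ := coeff_eq_zero h hx0 (p := -c') (q := d * (y * y)) (neg_mem hc')
    (mul_mem hd hyy) (by linear_combination hp)
  have hd0' : d = 0 := by simpa [hyne] using hd0
  apply hw0
  rw [hw1, hab, hc0, hd0']
  ring

theorem IsMin.exists_common_of_sameDim (h : SqMem k K) {P : Subalgebra k K}
    [FiniteDimensional k (Subalgebra.toSubmodule P)] {S T : Submodule k K}
    [FiniteDimensional k T] (hm : IsMin S) (hS : S ≤ Subalgebra.toSubmodule P)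
    (hH : SameDim P S T) {x y u v : K} (hx : x ∈ S) (hy : y ∈ S)
    (hx0 : x ∉ (⊥ : Subalgebra k K)) (hy0 : y ∉ (⊥ : Subalgebra k K))
    (hu : u ∈ T) (hux : x * u ∈ T) (hv : v ∈ T) (hvy : y * v ∈ T) (hu0 : u ≠ 0) (hv0 : v ≠ 0) :
    ∃ a ∈ (⊥ : Subalgebra k K), ∃ b ∈ (⊥ : Subalgebra k K), ∃ c ∈ (⊥ : Subalgebra k K),
      ∃ d ∈ (⊥ : Subalgebra k K), a + b * x ≠ 0 ∧ u * (a + b * x) = v * (c + d * y) := by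
  have : FiniteDimensional k S := Submodule.finiteDimensional_of_le hS
  have hxne : x ≠ 0 := fun h0 => hx0 (h0 ▸ Subalgebra.zero_mem _)
  obtain ⟨w, hw, hw0, hxyw⟩ := exists_mul_mem h hH (P.mul_mem (hS hx) (hS hy)) hx hxne
    (by
      have := mul_mem_of_mem_bot (h.mem ⊥ x) hy
      rwa [show x * y * x = x * x * y by ring])
  have hH' : SameDim P S (u⁻¹ • T) := hH.smul_right (inv_ne_zero hu0)
  have h1 : (1 : K) ∈ u⁻¹ • T := by rwa [mem_inv_smul_iff hu0, mul_one]
  obtain ⟨hT', hm'⟩ := hm.of_sameDim hS hH' h1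
  obtain ⟨a, ha, b, hb, c, hc, d, hd, hne, he⟩ := hm'.exists_common h hT'
    (x := x) (y := y) (v := u⁻¹ * v) (w := u⁻¹ * w)
    (by rwa [mem_inv_smul_iff hu0, mul_comm])
    (by rwa [mem_inv_smul_iff hu0, mul_inv_cancel_left₀ hu0])
    (by rwa [mem_inv_smul_iff hu0, mul_assoc, mul_inv_cancel_left₀ hu0, mul_comm])
    (by rwa [mem_inv_smul_iff hu0, mul_inv_cancel_left₀ hu0])
    (by rwa [mem_inv_smul_iff hu0, mul_assoc, mul_inv_cancel_left₀ hu0, mul_comm])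
    hx0 hy0 (by positivity) (by positivity)
  refine ⟨a, ha, b, hb, c, hc, d, hd, hne, ?_⟩
  rw [he, mul_assoc, mul_inv_cancel_left₀ hu0]

/-- If `1, x, y` lie in both spaces, the minimal space `S` is contained in `T`. -/
theorem IsMin.le_of_sameDim (h : SqMem k K) {P : Subalgebra k K}
    [FiniteDimensional k (Subalgebra.toSubmodule P)] {S T : Submodule k K}
    [FiniteDimensional k T] (hm : IsMin S) (hS : S ≤ Subalgebra.toSubmodule P)
    (hH : SameDim P S T) {x y : K} (hx : x ∈ S) (hy : y ∈ S)
    (hx0 : x ∉ (⊥ : Subalgebra k K)) (hy0 : y ∉ quadExt h ⊥ x)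
    (h1 : (1 : K) ∈ T) (hxT : x ∈ T) (hyT : y ∈ T) : S ≤ T := by
  have : FiniteDimensional k S := Submodule.finiteDimensional_of_le hS
  intro s hs
  have hxA := self_mem_quadExt h ⊥ x
  have hAle {R : Submodule k K} (hR : (1 : K) ∈ R) (hxR : x ∈ R) :
      Subalgebra.toSubmodule (quadExt h ⊥ x) ≤ R := by
    rintro _ ⟨a, ha, b, hb, rfl⟩
    exact R.add_mem (by simpa using mul_mem_of_mem_bot ha hR) (mul_mem_of_mem_bot hb hxR)
  have hyk : y ∉ (⊥ : Subalgebra k K) := fun hy1 => hy0 (le_quadExt h ⊥ x hy1)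
  set A := quadExt h ⊥ x with hA
  set U := Subalgebra.toSubmodule A ⊔ Submodule.span k {y} with hU
  have hUT : U ≤ T := sup_le (hAle h1 hxT) (by simpa using hyT)
  have hUS : U ≤ S := sup_le (hAle hm.1 hx) (by simpa using hy)
  by_cases hsU : s ∈ U
  · exact hUT hsU
  set B := quadExt h A y with hB
  have hAB : A ≤ B := le_quadExt h A y
  have hyB : y ∈ B := self_mem_quadExt h A y
  have h1U : (1 : K) ∈ U := Submodule.mem_sup_left (S := Subalgebra.toSubmodule A) A.one_mem
  have hBU : B ≤ Algebra.adjoin k (U : Set K) := by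
    refine quadExt_le h (fun z hz => Algebra.subset_adjoin
      (Submodule.mem_sup_left (S := Subalgebra.toSubmodule A) hz)) (Algebra.subset_adjoin ?_)
    exact Submodule.mem_sup_right (Submodule.mem_span_singleton_self y)
  have hsB : s ∉ B := fun hsB => hsU (hm.mem_of_mem_adjoin h hS hUS h1U hs (hBU hsB))
  have bA : ∀ {z : K}, z ∈ (⊥ : Subalgebra k K) → z ∈ A := fun hz => (bot_le : ⊥ ≤ A) hz
  have hsk : s ∉ (⊥ : Subalgebra k K) := fun hs1 => hsB (hAB (bA hs1))
  obtain ⟨v, hv, hv0, hsv⟩ := exists_mul_mem h hH (hS hs) hm.1 one_ne_zero (by simpa using hs)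
  obtain ⟨a, ha, b, hb, c, hc, d, hd, hne, he⟩ := hm.exists_common_of_sameDim h hS hH hx hs
    hx0 hsk h1 (by simpa using hxT) hv hsv one_ne_zero hv0
  obtain ⟨a', ha', b', hb', c', hc', d', hd', hne', he'⟩ :=
    hm.exists_common_of_sameDim h hS hH hy hs hyk hsk h1 (by simpa using hyT) hv hsv
      one_ne_zero hv0
  rw [one_mul] at he he'
  have hax : a + b * x ∈ A := A.add_mem (bA ha) (A.mul_mem (bA hb) hxA)
  have hay : a' + b' * y ∈ B :=
    B.add_mem (hAB (bA ha')) (B.mul_mem (hAB (bA hb')) hyB)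
  obtain ⟨e1, e2⟩ := coeff_eq_zero h hsB
    (p := (a + b * x) * c' - (a' + b' * y) * c) (q := (a + b * x) * d' - (a' + b' * y) * d)
    (B.sub_mem (B.mul_mem (hAB hax) (hAB (bA hc'))) (B.mul_mem hay (hAB (bA hc))))
    (B.sub_mem (B.mul_mem (hAB hax) (hAB (bA hd'))) (B.mul_mem hay (hAB (bA hd))))
    (by linear_combination (c' + d' * s) * he - (c + d * s) * he')
  have key {r r' : K} (hr : r ∈ (⊥ : Subalgebra k K)) (hr' : r' ∈ (⊥ : Subalgebra k K))
      (e : (a + b * x) * r' - (a' + b' * y) * r = 0) : b * r' = 0 := by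
    obtain ⟨e3, -⟩ := coeff_eq_zero h hy0 (p := (a + b * x) * r' - a' * r) (q := -(b' * r))
      (A.sub_mem (A.mul_mem hax (bA hr')) (bA (mul_mem ha' hr)))
      (A.neg_mem (bA (mul_mem hb' hr))) (by linear_combination e)
    exact (coeff_eq_zero h hx0 (p := a * r' - a' * r) (q := b * r')
      (sub_mem (mul_mem ha hr') (mul_mem ha' hr)) (mul_mem hb hr')
      (by linear_combination e3)).2
  have hb0 : b = 0 := by
    by_contra hb0
    apply hne'
    rw [he', (mul_eq_zero_iff_left hb0).1 (key hc hc' e1),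
      (mul_eq_zero_iff_left hb0).1 (key hd hd' e2)]
    ring
  rw [hb0, zero_mul, add_zero] at he hne
  have : s = a⁻¹ * (c * (s * v) + d * (s * s * v)) := by
    rw [eq_inv_mul_iff_mul_eq₀ hne, he]
    ring
  rw [this]
  exact mul_mem_of_mem_bot (h.inv_mem ⊥ ha) (T.add_mem (mul_mem_of_mem_bot hc hsv)
    (mul_mem_of_mem_bot hd (mul_mem_of_mem_bot (h.mem ⊥ s) hv)))

theorem exists_smul_of_isMin (h : SqMem k K) {P : Subalgebra k K}
    [FiniteDimensional k (Subalgebra.toSubmodule P)] {S T : Submodule k K}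
    [FiniteDimensional k T] (hm : IsMin S) (hS : S ≤ Subalgebra.toSubmodule P)
    (hH : SameDim P S T) : ∃ t : K, t ≠ 0 ∧ T = t • S := by
  have : FiniteDimensional k S := Submodule.finiteDimensional_of_le hS
  suffices ∃ u : K, u ≠ 0 ∧ S ≤ u⁻¹ • T by
    obtain ⟨u, hu0, hle⟩ := this
    refine ⟨u, hu0, ?_⟩
    rw [Submodule.eq_of_le_of_finrank_eq hle
      (by rw [finrank_smul (inv_ne_zero hu0), hH.finrank_eq]), smul_inv_smul₀ hu0]
  by_cases hbot : S ≤ Subalgebra.toSubmodule ⊥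
  · obtain ⟨t, ht, ht0, -⟩ := exists_mul_mem h hH P.zero_mem hm.1 one_ne_zero (by simp)
    refine ⟨t, ht0, fun s hs => ?_⟩
    rw [mem_inv_smul_iff ht0, mul_comm]
    exact mul_mem_of_mem_bot (hbot hs) ht
  obtain ⟨x, hx, hx0⟩ := SetLike.not_le_iff_exists.1 hbot
  obtain ⟨u, hu, hu0, hxu⟩ := exists_mul_mem h hH (hS hx) hm.1 one_ne_zero (by simpa using hx)
  by_cases hA : S ≤ Subalgebra.toSubmodule (quadExt h ⊥ x)
  · refine ⟨u, hu0, fun s hs => ?_⟩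
    obtain ⟨a, ha, b, hb, rfl⟩ := hA hs
    rw [mem_inv_smul_iff hu0, show u * (a + b * x) = a * u + b * (x * u) by ring]
    exact T.add_mem (mul_mem_of_mem_bot ha hu) (mul_mem_of_mem_bot hb hxu)
  obtain ⟨y, hy, hy0⟩ := SetLike.not_le_iff_exists.1 hA
  have hyk : y ∉ (⊥ : Subalgebra k K) := fun hy1 => hy0 (le_quadExt h ⊥ x hy1)
  obtain ⟨v, hv, hv0, hyv⟩ := exists_mul_mem h hH (hS hy) hm.1 one_ne_zero (by simpa using hy)
  obtain ⟨a, ha, b, hb, c, hc, d, hd, hne, he⟩ := hm.exists_common_of_sameDim h hS hH hx hy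
    hx0 hyk hu hxu hv hyv hu0 hv0
  have hz0 : u * (a + b * x) ≠ 0 := mul_ne_zero hu0 hne
  refine ⟨u * (a + b * x), hz0, hm.le_of_sameDim h hS (hH.smul_right (inv_ne_zero hz0)) hx hy
    hx0 hy0 ?_ ?_ ?_⟩ <;> rw [mem_inv_smul_iff hz0]
  · rw [show u * (a + b * x) * 1 = a * u + b * (x * u) by ring]
    exact T.add_mem (mul_mem_of_mem_bot ha hu) (mul_mem_of_mem_bot hb hxu)
  · rw [show u * (a + b * x) * x = a * (x * u) + b * (x * x * u) by ring]
    exact T.add_mem (mul_mem_of_mem_bot ha hxu)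
      (mul_mem_of_mem_bot hb (mul_mem_of_mem_bot (h.mem ⊥ x) hu))
  · rw [he, show v * (c + d * y) * y = c * (y * v) + d * (y * y * v) by ring]
    exact T.add_mem (mul_mem_of_mem_bot hc hyv)
      (mul_mem_of_mem_bot hd (mul_mem_of_mem_bot (h.mem ⊥ y) hv))

theorem smul_toSubmodule_eq (h : SqMem k K) {P : Subalgebra k K} {t : K} (ht : t ∈ P)
    (ht0 : t ≠ 0) : t • Subalgebra.toSubmodule P = Subalgebra.toSubmodule P := by
  ext x
  rw [Submodule.mem_smul_iff_inv_mul_mem ht0]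
  refine ⟨fun hx => ?_, fun hx => P.mul_mem (h.inv_mem P ht) hx⟩
  have := P.mul_mem ht hx
  rwa [mul_inv_cancel_left₀ ht0] at this

theorem mul_le_of_le {P M : Subalgebra k K} {R : Submodule k K} (hM : M ≤ P)
    (hR : R ≤ Subalgebra.toSubmodule P) :
    Subalgebra.toSubmodule M * R ≤ Subalgebra.toSubmodule P :=
  (mul_le_mul_right hR _).trans (mul_eq_self_of_le hM).le

theorem finrank_mul_sup_smul (h : SqMem k K) {P M : Subalgebra k K}
    [FiniteDimensional k (Subalgebra.toSubmodule P)] (hM : M ≤ P) {b : K} (hb : b ∉ P)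
    {R : Submodule k K} (hR : R ≤ Subalgebra.toSubmodule P) :
    finrank k ↥(Subalgebra.toSubmodule M * (Subalgebra.toSubmodule P ⊔ b • R)) =
      finrank k (Subalgebra.toSubmodule P) + finrank k ↥(Subalgebra.toSubmodule M * R) := by
  have hb0 : b ≠ 0 := fun h0 => hb (h0 ▸ P.zero_mem)
  have hMR := mul_le_of_le hM hR
  have : FiniteDimensional k ↥(Subalgebra.toSubmodule M * R) :=
    Submodule.finiteDimensional_of_le hMR
  rw [Submodule.mul_sup, mul_eq_self_of_le hM, mul_smul_comm]
  have hdis : Subalgebra.toSubmodule P ⊓ b • (Subalgebra.toSubmodule M * R) = ⊥ := by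
    rw [eq_bot_iff]
    rintro _ ⟨hx, ⟨r, hr, rfl⟩⟩
    have := (coeff_eq_zero h hb (P.neg_mem hx) (hMR hr) (by
      simp only [DistribSMul.toLinearMap_apply, smul_eq_mul]; ring)).2
    simp [this]
  have := Submodule.finrank_sup_add_finrank_inf_eq (Subalgebra.toSubmodule P)
    (b • (Subalgebra.toSubmodule M * R))
  rwa [hdis, finrank_bot, add_zero, finrank_smul hb0] at this

/-- Rigidity of `P + bS`: it is determined up to a factor by its dimensions over
subalgebras as soon as the same holds for `S` inside `P`. -/
theorem exists_smul_of_sup_smul (h : SqMem k K) {P : Subalgebra k K}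
    [FiniteDimensional k (Subalgebra.toSubmodule P)] {b c : K} {S W : Submodule k K}
    [FiniteDimensional k W] (hS : S ≤ Subalgebra.toSubmodule P)
    (hdis : Disjoint (Subalgebra.toSubmodule P) (b • S)) (hb0 : b ≠ 0) (hc0 : c ≠ 0)
    (hcW : c • Subalgebra.toSubmodule P ≤ W)
    (hH : SameDim ⊤ (Subalgebra.toSubmodule P ⊔ b • S) W)
    (hrig : S ≠ ⊥ → ∀ T : Submodule k K, T ≤ Subalgebra.toSubmodule P → SameDim P S T →
      ∃ t : K, t ≠ 0 ∧ T = t • S) :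
    ∃ x : K, x ≠ 0 ∧ W = x • (Subalgebra.toSubmodule P ⊔ b • S) := by
  have hSfin : FiniteDimensional k S := Submodule.finiteDimensional_of_le hS
  by_cases hS0 : S = ⊥
  · subst hS0
    have e : b • (⊥ : Submodule k K) = ⊥ := by simp
    rw [e, sup_bot_eq] at hH ⊢
    exact ⟨c, hc0, (Submodule.eq_of_le_of_finrank_eq hcW
      (by rw [finrank_smul hc0, hH.finrank_eq])).symm⟩
  obtain ⟨s, hs, hs0⟩ := Submodule.exists_mem_ne_zero_of_ne_bot hS0
  have hb : b ∉ P := by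
    intro hbP
    have h1 : b * s ∈ Subalgebra.toSubmodule P := P.mul_mem hbP (hS hs)
    have := Submodule.disjoint_def.1 hdis _ h1 ⟨s, hs, rfl⟩
    exact mul_ne_zero hb0 hs0 this
  have hc' : c⁻¹ ≠ 0 := inv_ne_zero hc0
  have hPW : Subalgebra.toSubmodule P ≤ c⁻¹ • W := by
    intro p hp
    rw [mem_inv_smul_iff hc0]
    exact hcW ⟨p, hp, rfl⟩
  have hH' := hH.smul_right hc'
  have hWL : c⁻¹ • W ≤ Subalgebra.toSubmodule (quadExt h P b) := by
    refine (hH'.mono le_top).le_subalgebra ?_ (Submodule.mem_sup_left P.one_mem)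
      (hPW P.one_mem)
    rw [toSubmodule_quadExt]
    exact sup_le_sup_left (Submodule.map_mono hS) _
  set T := Subalgebra.toSubmodule P ⊓ b⁻¹ • c⁻¹ • W with hT
  have hW : c⁻¹ • W = Subalgebra.toSubmodule P ⊔ b • T := by
    apply le_antisymm
    · intro w hw
      obtain ⟨p, hp, q, hq, rfl⟩ := hWL hw
      refine Submodule.add_mem_sup hp ⟨q, ⟨hq, ?_⟩, mul_comm _ _⟩
      refine (mem_inv_smul_iff hb0).2 ?_
      have := Submodule.sub_mem _ hw (hPW hp)
      rwa [add_sub_cancel_left, mul_comm] at this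
    · refine sup_le hPW ?_
      rintro _ ⟨q, ⟨-, hq⟩, rfl⟩
      exact (mem_inv_smul_iff hb0).1 hq
  have hTP : T ≤ Subalgebra.toSubmodule P := inf_le_left
  have hST : SameDim P S T := by
    intro M hM
    have := hH' M le_top
    rw [hW, finrank_mul_sup_smul h hM hb hS, finrank_mul_sup_smul h hM hb hTP] at this
    omega
  obtain ⟨t, ht0, hTS⟩ := hrig hS0 T hTP hST
  have htP : t ∈ P := by
    have h1 : t * s ∈ T := hTS ▸ ⟨s, hs, rfl⟩
    have := h.div_mem P h1.1 (hS hs)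
    rwa [mul_div_cancel_right₀ t hs0] at this
  refine ⟨c * t, mul_ne_zero hc0 ht0, ?_⟩
  rw [mul_smul, Submodule.smul_sup', smul_toSubmodule_eq h htP ht0, smul_comm t b, ← hTS, ← hW,
    smul_inv_smul₀ hc0]

theorem sqMem_pthSubfield (K : Type*) [Field K] : SqMem (QLF.pthSubfield 2 K) K :=
  fun x => ⟨⟨x ^ 2, Subfield.subset_closure ⟨x, rfl⟩⟩, rfl⟩

theorem exists_sq_of_mem_pthSubfield {K : Type*} [Field K] [CharP K 2] {x : K}
    (hx : x ∈ QLF.pthSubfield 2 K) : ∃ y : K, y ^ 2 = x := by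
  have h : QLF.pthSubfield 2 K ≤ (frobenius K 2).fieldRange :=
    Subfield.closure_le.2 (by rintro _ ⟨y, rfl⟩; exact ⟨y, rfl⟩)
  exact h hx

/-- The values of a totally singular quadratic form, as a space over the field of squares. -/
abbrev valueSpace {K ι : Type*} [Field K] (a : ι → K) : Submodule (QLF.pthSubfield 2 K) K :=
  Submodule.span _ (Set.range a)

section

variable {K : Type*} [Field K] {ι κ : Type*}

instance finite_valueSpace [Finite ι] (a : ι → K) :
    FiniteDimensional (QLF.pthSubfield 2 K) (valueSpace a) :=
  FiniteDimensional.span_of_finite _ (Set.finite_range a)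

theorem mem_valueSpace [CharP K 2] [Fintype ι] {a : ι → K} {x : K} :
    x ∈ valueSpace a ↔ x ∈ QLF.values 2 a := by
  rw [Submodule.mem_span_range_iff_exists_fun]
  constructor
  · rintro ⟨c, rfl⟩
    choose y hy using fun i => exists_sq_of_mem_pthSubfield (c i).2
    refine ⟨y, Finset.sum_congr rfl fun i _ => ?_⟩
    rw [hy, mul_comm]
    rfl
  · rintro ⟨y, rfl⟩
    refine ⟨fun i => ⟨y i ^ 2, Subfield.subset_closure ⟨y i, rfl⟩⟩,
      Finset.sum_congr rfl fun i _ => ?_⟩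
    rw [mul_comm]
    rfl

theorem valueSpace_eq_iff [CharP K 2] [Fintype ι] [Fintype κ] {a : ι → K} {b : κ → K} :
    valueSpace a = valueSpace b ↔ QLF.values 2 a = QLF.values 2 b := by
  simp only [SetLike.ext_iff, Set.ext_iff, mem_valueSpace]

theorem valueSpace_le_iff [CharP K 2] [Fintype ι] [Fintype κ] {a : ι → K} {b : κ → K} :
    valueSpace a ≤ valueSpace b ↔ QLF.values 2 a ⊆ QLF.values 2 b := by
  simp only [SetLike.le_def, Set.subset_def, mem_valueSpace]

theorem valueSpace_mul (c : K) (a : ι → K) :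
    valueSpace (fun i => c * a i) = c • valueSpace a := by
  rw [← Submodule.span_smul, ← Set.image_smul, ← Set.range_comp]
  rfl

theorem valueSpace_sum (a : ι → K) (b : κ → K) :
    valueSpace (Sum.elim a b) = valueSpace a ⊔ valueSpace b := by
  rw [valueSpace, Set.Sum.elim_range, Submodule.span_union]

theorem valueSpace_zero (ι : Type*) : valueSpace (fun _ : ι => (0 : K)) = ⊥ := by
  rw [Submodule.span_eq_bot]
  rintro _ ⟨i, rfl⟩
  rfl

theorem values_subset_of_subform {p : ℕ} [Fintype ι] [Fintype κ] {a : ι → K} {b : κ → K}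
    (h : QLF.Subform p a b) : QLF.values p a ⊆ QLF.values p b := by
  obtain ⟨T, -, hT⟩ := h
  rintro _ ⟨x, rfl⟩
  exact ⟨T x, (hT x).symm⟩

theorem values_eq_of_isometric {p : ℕ} [Fintype ι] [Fintype κ] {a : ι → K} {b : κ → K}
    (h : QLF.Isometric p a b) : QLF.values p a = QLF.values p b := by
  obtain ⟨T, hT⟩ := h
  apply Set.Subset.antisymm
  · rintro _ ⟨x, rfl⟩
    exact ⟨T x, (hT x).symm⟩
  · rintro _ ⟨x, rfl⟩
    exact ⟨T.symm x, by rw [hT, T.apply_symm_apply]⟩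

theorem anisotropic_of_isometric {p : ℕ} [Fintype ι] [Fintype κ] {a : ι → K} {b : κ → K}
    (h : QLF.Isometric p a b) (ha : QLF.Anisotropic p a) : QLF.Anisotropic p b := by
  obtain ⟨T, hT⟩ := h
  rintro ⟨x, hx, hx0⟩
  exact ha ⟨T.symm x, by simpa using hx, by rw [hT, T.apply_symm_apply, hx0]⟩

theorem anisotropic_of_mul {p : ℕ} [Fintype ι] {c : K} {a : ι → K}
    (h : QLF.Anisotropic p fun i => c * a i) : QLF.Anisotropic p a := by
  rintro ⟨x, hx, hx0⟩
  refine h ⟨x, hx, ?_⟩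
  rw [QLF.eval] at hx0 ⊢
  simp only [mul_assoc, ← Finset.mul_sum, hx0, mul_zero]

theorem linearIndependent_of_anisotropic [CharP K 2] [Fintype ι] {a : ι → K}
    (h : QLF.Anisotropic 2 a) : LinearIndependent (QLF.pthSubfield 2 K) a := by
  rw [Fintype.linearIndependent_iff]
  intro c hc i
  choose y hy using fun i => exists_sq_of_mem_pthSubfield (c i).2
  have hy0 : y = 0 := by
    by_contra hne
    refine h ⟨y, hne, ?_⟩
    rw [← hc]
    refine Finset.sum_congr rfl fun i _ => ?_
    rw [hy, mul_comm]
    rfl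
  ext
  rw [← hy i, hy0]
  simp

theorem finrank_valueSpace [CharP K 2] [Fintype ι] {a : ι → K}
    (h : QLF.Anisotropic 2 a) :
    finrank (QLF.pthSubfield 2 K) (valueSpace a) = Fintype.card ι :=
  finrank_span_eq_card (linearIndependent_of_anisotropic h)

/-- The values of a quasi-Pfister form constitute a subalgebra. -/
theorem valueSpace_pfister {n : ℕ} (b : Fin n → K) :
    valueSpace (QLF.pfister 2 b) =
      Subalgebra.toSubmodule (Algebra.adjoin (QLF.pthSubfield 2 K) (Set.range b)) := by
  apply le_antisymm
  · rw [Submodule.span_le]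
    rintro _ ⟨e, rfl⟩
    exact Subalgebra.prod_mem _ fun i _ =>
      Subalgebra.pow_mem _ (Algebra.subset_adjoin (Set.mem_range_self i)) _
  have hstep : ∀ i, ∀ v ∈ valueSpace (QLF.pfister 2 b), b i * v ∈ valueSpace (QLF.pfister 2 b) := by
    intro i v hv
    induction hv using Submodule.span_induction with
    | mem v hv =>
      obtain ⟨e, rfl⟩ := hv
      have hsplit : ∀ e' : Fin n → Fin 2, QLF.pfister 2 b e' =
          b i ^ (e' i : ℕ) * ∏ j ∈ Finset.univ.erase i, b j ^ (e' j : ℕ) := fun e' =>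
        (Finset.mul_prod_erase Finset.univ (fun j => b j ^ (e' j : ℕ)) (Finset.mem_univ i)).symm
      have hupd : ∀ t : Fin 2, QLF.pfister 2 b (Function.update e i t) =
          b i ^ (t : ℕ) * ∏ j ∈ Finset.univ.erase i, b j ^ (e j : ℕ) := by
        intro t
        rw [hsplit, Function.update_self]
        congr 1
        refine Finset.prod_congr rfl fun j hj => ?_
        rw [Function.update_of_ne (Finset.ne_of_mem_erase hj)]
      rw [hsplit e]
      generalize hei : e i = t
      fin_cases t
      · refine Submodule.subset_span ⟨Function.update e i 1, ?_⟩
        rw [hupd]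
        simp
      · obtain ⟨a, ha⟩ := sqMem_pthSubfield K (b i)
        have := Submodule.smul_mem _ a
          (Submodule.subset_span (R := QLF.pthSubfield 2 K)
            (Set.mem_range_self (f := QLF.pfister 2 b) (Function.update e i 0)))
        rw [Algebra.smul_def, ha, hupd] at this
        convert this using 1
        simp
        ring
    | zero => simp
    | add x y _ _ hx hy => rw [mul_add]; exact Submodule.add_mem _ hx hy
    | smul a x _ hx => rw [mul_smul_comm]; exact Submodule.smul_mem _ a hx
  have hmul : ∀ x ∈ Algebra.adjoin (QLF.pthSubfield 2 K) (Set.range b),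
      ∀ v ∈ valueSpace (QLF.pfister 2 b), x * v ∈ valueSpace (QLF.pfister 2 b) := by
    intro x hx
    induction hx using Algebra.adjoin_induction with
    | mem x hx =>
      obtain ⟨i, rfl⟩ := hx
      exact hstep i
    | algebraMap r =>
      intro v hv
      rw [← Algebra.smul_def]
      exact Submodule.smul_mem _ r hv
    | add x y _ _ hx hy =>
      intro v hv
      rw [add_mul]
      exact Submodule.add_mem _ (hx v hv) (hy v hv)
    | mul x y _ _ hx hy =>
      intro v hv
      rw [mul_assoc]
      exact hx _ (hy v hv)
  intro x hx
  rw [← mul_one x]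
  exact hmul x hx 1 (Submodule.subset_span ⟨0, by simp [QLF.pfister]⟩)

end

/-- Linear maps with equal ranges and equidimensional sources differ by an isomorphism. -/
theorem exists_equiv_of_range_eq {F V V' X : Type*} [Field F] [AddCommGroup V] [Module F V]
    [AddCommGroup V'] [Module F V'] [AddCommGroup X] [Module F X] [FiniteDimensional F V]
    [FiniteDimensional F V'] (hd : finrank F V = finrank F V') (A : V →ₗ[F] X) (B : V' →ₗ[F] X)
    (h : LinearMap.range A = LinearMap.range B) : ∃ T : V ≃ₗ[F] V', ∀ x, A x = B (T x) := by
  have hker : finrank F (LinearMap.ker A) = finrank F (LinearMap.ker B) := by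
    have h1 := A.finrank_range_add_finrank_ker
    have h2 := B.finrank_range_add_finrank_ker
    rw [h] at h1
    omega
  let e := LinearEquiv.ofFinrankEq _ _ hker
  obtain ⟨q, hq⟩ := (LinearMap.ker A).subtype.exists_leftInverse_of_injective
    (LinearMap.ker_eq_bot.2 Subtype.val_injective)
  obtain ⟨s, hs⟩ := Module.projective_lifting_property B.rangeRestrict
    (A.codRestrict (LinearMap.range B) fun x => h ▸ LinearMap.mem_range_self A x)
    B.surjective_rangeRestrict
  have hs' : ∀ x, B (s x) = A x := fun x =>
    congrArg Subtype.val (LinearMap.congr_fun hs x)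
  let T : V →ₗ[F] V' := s ∘ₗ (LinearMap.id - (LinearMap.ker A).subtype ∘ₗ q) +
    (LinearMap.ker B).subtype ∘ₗ e.toLinearMap ∘ₗ q
  have hTapp : ∀ x, T x = s (x - (q x : V)) + (e (q x) : V') := fun x => rfl
  have hT : ∀ x, B (T x) = A x := fun x => by
    rw [hTapp, map_add, hs', map_sub, LinearMap.mem_ker.1 (q x).2, LinearMap.mem_ker.1 (e (q x)).2,
      sub_zero, add_zero]
  have hinj : Function.Injective T := by
    rw [← LinearMap.ker_eq_bot, LinearMap.ker_eq_bot']
    intro x hx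
    have hxA : x ∈ LinearMap.ker A := by rw [LinearMap.mem_ker, ← hT, hx, map_zero]
    have hqx : q x = ⟨x, hxA⟩ := LinearMap.congr_fun hq ⟨x, hxA⟩
    have h0 : e ⟨x, hxA⟩ = 0 := by
      rw [hTapp, hqx] at hx
      simpa using hx
    simpa using h0
  refine ⟨LinearEquiv.ofInjectiveOfFinrankEq T hinj hd, fun x => (hT x).symm⟩

theorem linearCombination_sq {F Ω : Type*} [Field F] [Field Ω] [CharP Ω 2] [Algebra F Ω]
    {g : F → Ω} (hg : ∀ x, g x ^ 2 = algebraMap F Ω x) {ι : Type*} [Fintype ι] (a : ι → F)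
    (x : ι → F) :
    (Fintype.linearCombination F (g ∘ a) x) ^ 2 = algebraMap F Ω (QLF.eval 2 a x) := by
  rw [Fintype.linearCombination_apply, sum_pow_char, QLF.eval, map_sum]
  refine Finset.sum_congr rfl fun i _ => ?_
  rw [Algebra.smul_def, mul_pow, Function.comp_apply, hg, map_mul, map_pow, mul_comm]

theorem range_linearCombination_le {F Ω : Type*} [Field F] [Field Ω] [CharP Ω 2] [Algebra F Ω]
    {g : F → Ω} (hg : ∀ x, g x ^ 2 = algebraMap F Ω x) {ι κ : Type*} [Fintype ι] [Fintype κ]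
    {a : ι → F} {b : κ → F} (h : QLF.values 2 a ⊆ QLF.values 2 b) :
    LinearMap.range (Fintype.linearCombination F (g ∘ a)) ≤
      LinearMap.range (Fintype.linearCombination F (g ∘ b)) := by
  rintro _ ⟨x, rfl⟩
  obtain ⟨y, hy⟩ := h ⟨x, rfl⟩
  refine ⟨y, frobenius_inj Ω 2 ?_⟩
  rw [frobenius_def, frobenius_def, linearCombination_sq hg, linearCombination_sq hg, hy]

theorem isometric_of_values_eq {F : Type*} [Field F] [CharP F 2] {ι κ : Type*} [Fintype ι]
    [Fintype κ] (hc : Fintype.card ι = Fintype.card κ) {a : ι → F} {b : κ → F}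
    (h : QLF.values 2 a = QLF.values 2 b) : QLF.Isometric 2 a b := by
  let Ω := AlgebraicClosure F
  have : CharP Ω 2 := charP_of_injective_algebraMap (algebraMap F Ω).injective 2
  have hsq : ∀ x : F, ∃ y : Ω, y ^ 2 = algebraMap F Ω x := fun x =>
    IsAlgClosed.exists_pow_nat_eq _ two_pos
  choose g hg using hsq
  obtain ⟨T, hT⟩ := exists_equiv_of_range_eq (by simpa using hc)
    (Fintype.linearCombination F (g ∘ a)) (Fintype.linearCombination F (g ∘ b))
    (le_antisymm (range_linearCombination_le hg h.subset)
      (range_linearCombination_le hg h.superset))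
  refine ⟨T, fun x => (algebraMap F Ω).injective ?_⟩
  rw [← linearCombination_sq hg, ← linearCombination_sq hg, hT]

/-- A subalgebra, regarded as an intermediate field. -/
def toField (h : SqMem k K) (A : Subalgebra k K) : IntermediateField k K :=
  A.toIntermediateField fun _ hx => h.inv_mem A hx

theorem toSubmodule_mul_span (h : SqMem k K) (A : Subalgebra k K) (s : Set K) :
    Subalgebra.toSubmodule A * Submodule.span k s =
      (Submodule.span (toField h A) s).restrictScalars k := by
  apply le_antisymm
  · rw [Submodule.mul_le]
    intro m hm x hx
    exact Submodule.smul_mem (Submodule.span (toField h A) s) (⟨m, hm⟩ : toField h A)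
      (Submodule.span_le_restrictScalars k _ s hx)
  · intro x (hx : x ∈ Submodule.span (toField h A) s)
    induction hx using Submodule.span_induction with
    | mem x hx => exact le_mul_left A _ (Submodule.subset_span hx)
    | zero => exact Submodule.zero_mem _
    | add x y _ _ hx hy => exact Submodule.add_mem _ hx hy
    | smul c x _ hx =>
      have := Submodule.mul_mem_mul (show (c : K) ∈ Subalgebra.toSubmodule A from c.2) hx
      rwa [← mul_assoc, mul_eq_self_of_le le_rfl] at this

theorem finrank_toSubmodule_mul_span (h : SqMem k K) (A : Subalgebra k K) (s : Set K) :
    finrank k ↥(Subalgebra.toSubmodule A * Submodule.span k s) =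
      finrank k (toField h A) * finrank (toField h A) (Submodule.span (toField h A) s) := by
  rw [toSubmodule_mul_span h]
  exact (Module.finrank_mul_finrank k (toField h A) (Submodule.span (toField h A) s)).symm

theorem defect_add_finrank {F E K : Type*} [Field F] [Field E] [CharP E 2] [Field K]
    [Algebra E K] (f : F →+* K) (g : F →+* E)
    (hg : ∀ x, algebraMap E K (g x) = f x ^ 2) {ι : Type*} [Fintype ι] (a : ι → F) :
    finrank E (Submodule.span E (Set.range (f ∘ a))) + QLF.defect 2 (g ∘ a) =
      Fintype.card ι := by
  have : CharP K 2 := charP_of_injective_algebraMap (algebraMap E K).injective 2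
  have hker : QLF.zeroSubmodule 2 (g ∘ a) =
      LinearMap.ker (Fintype.linearCombination E (f ∘ a)) := by
    ext y
    rw [LinearMap.mem_ker, ← pow_eq_zero_iff two_ne_zero, Fintype.linearCombination_apply,
      sum_pow_char, show y ∈ QLF.zeroSubmodule 2 (g ∘ a) ↔ QLF.eval 2 (g ∘ a) y = 0 from Iff.rfl,
      ← map_eq_zero (algebraMap E K), QLF.eval, map_sum]
    simp only [Function.comp_apply, map_mul, hg, map_pow, Algebra.smul_def, mul_pow, mul_comm]
  have := (Fintype.linearCombination E (f ∘ a)).finrank_range_add_finrank_ker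
  rwa [Fintype.range_linearCombination, ← hker, Module.finrank_fintype_fun_eq_card] at this

theorem sameDim_of_vishikEquiv {F K : Type u} [Field F] [CharP F 2] [Field K] [CharP K 2]
    {ι κ : Type*} [Fintype ι] [Fintype κ] {φ : ι → F} {ψ : κ → F}
    (h : QLF.VishikEquiv 2 φ ψ) (f : F →+* K) :
    SameDim ⊤ (valueSpace (f ∘ φ)) (valueSpace (f ∘ ψ)) := by
  intro M _
  have hsq := sqMem_pthSubfield K
  have : CharP (toField hsq M) 2 :=
    (algebraMap (toField hsq M) K).charP (algebraMap (toField hsq M) K).injective 2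
  let g : F →+* toField hsq M := ((frobenius K 2).comp f).codRestrict (toField hsq M) fun x => by
    change (f x) ^ 2 ∈ M
    rw [pow_two]
    exact hsq.mem M _
  have h1 := defect_add_finrank f g (fun _ => rfl) φ
  have h2 := defect_add_finrank f g (fun _ => rfl) ψ
  rw [h.2 _ g] at h1
  rw [valueSpace, valueSpace, finrank_toSubmodule_mul_span hsq, finrank_toSubmodule_mul_span hsq]
  congr 1
  have := h.1
  omega
theorem mul_mem_valueSpace_of_mem_simFactors {F : Type*} [Field F] [CharP F 2] {ι : Type*}
    [Fintype ι] {φ : ι → F} {g : F} (hg : g ∈ QLF.simFactors 2 φ) {v : F}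
    (hv : v ∈ valueSpace φ) : g * v ∈ valueSpace φ := by
  rcases hg with ⟨-, hiso⟩ | hg
  · rw [← valueSpace_eq_iff.2 (values_eq_of_isometric hiso), valueSpace_mul]
    exact ⟨v, hv, rfl⟩
  · rw [Set.mem_singleton_iff.1 hg, zero_mul]
    exact Submodule.zero_mem _

/-- The similarity factors of a form are inherited by Vishik equivalent forms. -/
theorem mul_mem_valueSpace_of_vishikEquiv {F : Type u} [Field F] [CharP F 2] {ι κ : Type*}
    [Fintype ι] [Fintype κ] {φ : ι → F} {ψ : κ → F} (h : QLF.VishikEquiv 2 φ ψ) {g : F}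
    (hg : g ∈ QLF.simFactors 2 φ) {w : F} (hw : w ∈ valueSpace ψ) : g * w ∈ valueSpace ψ := by
  have hd : SameDim ⊤ (valueSpace φ) (valueSpace ψ) := sameDim_of_vishikEquiv h (RingHom.id F)
  let M := Algebra.adjoin (QLF.pthSubfield 2 F) {g}
  have hM : Subalgebra.toSubmodule M * valueSpace φ = valueSpace φ := by
    refine le_antisymm (Submodule.mul_le.2 fun x hx => ?_) (le_mul_left _ _)
    replace hx : x ∈ Algebra.adjoin (QLF.pthSubfield 2 F) {g} := hx
    induction hx using Algebra.adjoin_induction with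
    | mem x hx =>
      rw [Set.mem_singleton_iff.1 hx]
      exact fun v hv => mul_mem_valueSpace_of_mem_simFactors hg hv
    | algebraMap r =>
      intro v hv
      rw [← Algebra.smul_def]
      exact Submodule.smul_mem _ r hv
    | add x y _ _ hx hy =>
      intro v hv
      rw [add_mul]
      exact Submodule.add_mem _ (hx v hv) (hy v hv)
    | mul x y _ _ hx hy =>
      intro v hv
      rw [mul_assoc]
      exact hx _ (hy v hv)
  have : FiniteDimensional (QLF.pthSubfield 2 F) (Subalgebra.toSubmodule M) := by
    obtain ⟨a, ha⟩ := sqMem_pthSubfield F g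
    exact Module.Finite.iff_fg.2 (IsIntegral.fg_adjoin_singleton
      (IsIntegral.of_pow two_pos (ha ▸ isIntegral_algebraMap)))
  have := Submodule.eq_of_le_of_finrank_eq (le_mul_left M (valueSpace ψ))
    (by rw [← hd M le_top, hM, hd.finrank_eq])
  rw [this]
  exact Submodule.mul_mem_mul (Algebra.subset_adjoin rfl) hw

/-- If all squares of `K` come from scalars preserving the value space, then extending scalars
to `K` adds no new values. -/
theorem values_comp {F K : Type*} [Field F] [CharP F 2] [Field K] (f : F →+* K) {ι : Type*}
    [Fintype ι] (a : ι → F)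
    (h : ∀ y : K, ∃ g : F, f g = y ^ 2 ∧ ∀ v ∈ valueSpace a, g * v ∈ valueSpace a) :
    QLF.values 2 (f ∘ a) = f '' QLF.values 2 a := by
  apply Set.Subset.antisymm
  · rintro _ ⟨y, rfl⟩
    choose g hg hga using h
    refine ⟨∑ i, g (y i) * a i, ?_, ?_⟩
    · rw [← mem_valueSpace]
      exact Submodule.sum_mem _ fun i _ => hga _ _ (Submodule.subset_span ⟨i, rfl⟩)
    · rw [map_sum]
      refine Finset.sum_congr rfl fun i _ => ?_
      rw [map_mul, hg, mul_comm]
      rfl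
  · rintro _ ⟨_, ⟨x, rfl⟩, rfl⟩
    refine ⟨f ∘ x, ?_⟩
    simp [QLF.eval]

theorem isMin_of_minimal {K : Type*} [Field K] [CharP K 2] {ι : Type*} [Fintype ι] {a : ι → K}
    (h : QLF.Minimal 2 a) {P : Subalgebra (QLF.pthSubfield 2 K) K}
    [FiniteDimensional (QLF.pthSubfield 2 K) (Subalgebra.toSubmodule P)] {s : K}
    (hs : s ∈ valueSpace a) (hs0 : s ≠ 0)
    (hP : s⁻¹ • valueSpace a ≤ Subalgebra.toSubmodule P) : IsMin (s⁻¹ • valueSpace a) := by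
  have hsq := sqMem_pthSubfield K
  refine ⟨(mem_inv_smul_iff hs0).2 (by rwa [mul_one]), ?_⟩
  rw [finrank_smul (inv_ne_zero hs0), finrank_valueSpace h.1, ← h.2, QLF.ndeg, QLF.degOver]
  have := finite_adjoin hP
  refine Submodule.finrank_mono (Submodule.span_le.2 ?_)
  set A := Algebra.adjoin (QLF.pthSubfield 2 K)
    ((s⁻¹ • valueSpace a : Submodule (QLF.pthSubfield 2 K) K) : Set K) with hA
  have hmem : ∀ u ∈ QLF.values 2 a, s⁻¹ * u ∈ A := fun u hu =>
    Algebra.subset_adjoin ⟨u, mem_valueSpace.2 hu, rfl⟩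
  have hle : QLF.normField 2 a ≤ (toField hsq A).toSubfield := by
    refine Subfield.closure_le.2 (Set.union_subset ?_ ?_)
    · rintro _ ⟨x, rfl⟩
      change x ^ 2 ∈ A
      rw [pow_two]
      exact hsq.mem A x
    · rintro _ ⟨u, hu, v, hv, -, -, rfl⟩
      change u / v ∈ A
      have := hsq.div_mem A (hmem u hu) (hmem v hv)
      rwa [mul_div_mul_left _ _ (inv_ne_zero hs0)] at this
  exact hle

/-- The value spaces of the forms `σ` in question are rigid. -/
theorem exists_smul_valueSpace {K : Type*} [Field K] [CharP K 2] {ι : Type*} [Fintype ι]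
    {σ : ι → K} (han : QLF.Anisotropic 2 σ)
    (hσ : QLF.IsQuasiPfister 2 σ ∨ QLF.IsQPNeighborCodimOne 2 σ ∨ QLF.Minimal 2 σ)
    {P : Subalgebra (QLF.pthSubfield 2 K) K}
    [FiniteDimensional (QLF.pthSubfield 2 K) (Subalgebra.toSubmodule P)]
    (hP : valueSpace σ ≤ Subalgebra.toSubmodule P) (h0 : valueSpace σ ≠ ⊥)
    {T : Submodule (QLF.pthSubfield 2 K) K} (hT : T ≤ Subalgebra.toSubmodule P)
    (hH : SameDim P (valueSpace σ) T) : ∃ t : K, t ≠ 0 ∧ T = t • valueSpace σ := by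
  have hsq := sqMem_pthSubfield K
  have : FiniteDimensional (QLF.pthSubfield 2 K) T := Submodule.finiteDimensional_of_le hT
  rcases hσ with ⟨n, b, -, hiso⟩ | ⟨n, b, -, hb, ⟨e, he, hsub, -⟩, hcard⟩ | hmin
  · have hS := valueSpace_eq_iff.2 (values_eq_of_isometric hiso)
    rw [valueSpace_pfister] at hS
    exact exists_smul_of_eq_subalgebra hH (hS.symm.trans_le hP) hS
  · have heS := valueSpace_le_iff.2 (values_subset_of_subform hsub)
    have hM := finrank_valueSpace hb
    have hfin : FiniteDimensional (QLF.pthSubfield 2 K) (valueSpace (QLF.pfister 2 b)) :=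
      inferInstance
    rw [valueSpace_mul, valueSpace_pfister] at heS
    rw [valueSpace_pfister] at hM hfin
    refine exists_smul_of_codim_one hsq hP hH he heS ?_ h0
    rw [hM, finrank_valueSpace han, hcard]
    simp
  · obtain ⟨s, hs, hs0⟩ := Submodule.exists_mem_ne_zero_of_ne_bot h0
    have hs' := inv_ne_zero hs0
    have hSP : s⁻¹ • valueSpace σ ≤ Subalgebra.toSubmodule P := by
      rintro _ ⟨x, hx, rfl⟩
      exact P.mul_mem (hsq.inv_mem P (hP hs)) (hP hx)
    have hm := isMin_of_minimal hmin hs hs0 hSP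
    obtain ⟨t, ht, rfl⟩ := exists_smul_of_isMin hsq hm hSP (hH.smul_left hs')
    exact ⟨t * s⁻¹, mul_ne_zero ht hs', (mul_smul _ _ _).symm⟩

theorem disjoint_of_anisotropic_sum {K : Type*} [Field K] [CharP K 2] {ι κ : Type*} [Fintype ι]
    [Fintype κ] {a : ι → K} {b : κ → K} (h : QLF.Anisotropic 2 (Sum.elim a b)) :
    Disjoint (valueSpace a) (valueSpace b) := by
  have hli := linearIndependent_of_anisotropic h
  have := (linearIndependent_sum.1 hli).2.2
  rwa [Sum.elim_comp_inl, Sum.elim_comp_inr] at this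

theorem anisotropic_right_of_sum {K : Type*} [Field K] {ι κ : Type*} [Fintype ι]
    [Fintype κ] {a : ι → K} {b : κ → K} (h : QLF.Anisotropic 2 (Sum.elim a b)) :
    QLF.Anisotropic 2 b := by
  rintro ⟨x, hx, hx0⟩
  refine h ⟨Sum.elim 0 x, fun h0 => hx ?_, ?_⟩
  · ext i
    exact congrFun h0 (Sum.inr i)
  · simpa [QLF.eval] using hx0

/-- Over a field where the anisotropic part of `φ` is a suitable special quasi-Pfister neighbor,
Vishik equivalent forms have proportional value spaces. -/
theorem exists_valueSpace_comp_eq_smul {F : Type u} [Field F] [CharP F 2]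
    {n m : ℕ} {φ : Fin n → F} {ψ : Fin m → F} (h : QLF.VishikEquiv 2 φ ψ)
    {K : Type u} [Field K] [CharP K 2] (f : F →+* K)
    {k : ℕ} {φa : Fin k → K} (hφa : QLF.IsAnisotropicPart 2 (f ∘ φ) φa)
    {r s : ℕ} {πc : Fin r → K} {b : K} (hb : b ≠ 0) {σ : Fin s → K}
    (hσπ : QLF.Subform 2 σ (QLF.pfister 2 πc))
    (hspn : QLF.Similar 2 φa (Sum.elim (QLF.pfister 2 πc) fun j => b * σ j))
    {c : K} (hc : c ≠ 0)
    (hcπ : QLF.Subform 2 (fun e => c * QLF.pfister 2 πc e) (f ∘ ψ))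
    (hσ : QLF.IsQuasiPfister 2 σ ∨ QLF.IsQPNeighborCodimOne 2 σ ∨ QLF.Minimal 2 σ) :
    (∃ e ∈ valueSpace (f ∘ φ), e ≠ 0) ∧
      ∃ z : K, z ≠ 0 ∧ valueSpace (f ∘ φ) = z • valueSpace (f ∘ ψ) := by
  have hsq := sqMem_pthSubfield K
  obtain ⟨hφan, N, hφiso⟩ := hφa
  obtain ⟨e, he, hiso⟩ := hspn
  have han := anisotropic_of_mul (anisotropic_of_isometric hiso hφan)
  have hdis := disjoint_of_anisotropic_sum han
  have hσan := anisotropic_of_mul (anisotropic_right_of_sum han)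
  have hφK : valueSpace (f ∘ φ) = e • (valueSpace (QLF.pfister 2 πc) ⊔
      b • valueSpace σ) := by
    rw [valueSpace_eq_iff.2 (values_eq_of_isometric hφiso),
      valueSpace_sum, valueSpace_zero, sup_bot_eq,
      valueSpace_eq_iff.2 (values_eq_of_isometric hiso),
      valueSpace_mul, valueSpace_sum, valueSpace_mul]
  have hdim := sameDim_of_vishikEquiv h f
  have hσP := valueSpace_le_iff.2 (values_subset_of_subform hσπ)
  have hcP := valueSpace_le_iff.2 (values_subset_of_subform hcπ)
  have hfin : FiniteDimensional (QLF.pthSubfield 2 K)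
      (valueSpace (QLF.pfister 2 πc)) := inferInstance
  rw [valueSpace_mul] at hdis hcP
  rw [valueSpace_pfister] at hdis hcP hσP hφK hfin
  have hdim' := hdim.smul_left (inv_ne_zero he)
  rw [hφK, inv_smul_smul₀ he] at hdim'
  obtain ⟨x, hx, hxW⟩ := exists_smul_of_sup_smul hsq hσP hdis hb hc hcP hdim'
    fun h0 T hT hST => exists_smul_valueSpace hσan hσ hσP h0 hT hST
  refine ⟨⟨e, ?_, he⟩, e * x⁻¹, mul_ne_zero he (inv_ne_zero hx), ?_⟩
  · rw [hφK]
    exact ⟨1, Submodule.mem_sup_left (Subalgebra.one_mem _), mul_one e⟩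
  · rw [hφK, hxW, mul_smul, inv_smul_smul₀ hx]

/-- If `K² = G_F(φ)`, proportionality of the value spaces over `K` descends to `F`. -/
theorem similar_of_valueSpace_comp_eq_smul {F : Type u} [Field F] [CharP F 2]
    {n m : ℕ} {φ : Fin n → F} {ψ : Fin m → F} (h : QLF.VishikEquiv 2 φ ψ)
    {K : Type u} [Field K] [CharP K 2] (f : F →+* K)
    (hK : (Set.range fun y : K => y ^ 2) = f '' QLF.simFactors 2 φ)
    {e z : K} (he : e ∈ valueSpace (f ∘ φ)) (he0 : e ≠ 0) (hz : z ≠ 0)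
    (hzW : valueSpace (f ∘ φ) = z • valueSpace (f ∘ ψ)) : QLF.Similar 2 φ ψ := by
  have hsim : ∀ y : K, ∃ g : F, f g = y ^ 2 ∧ g ∈ QLF.simFactors 2 φ := fun y => by
    obtain ⟨g, hg, hgy⟩ := hK.subset ⟨y, rfl⟩
    exact ⟨g, hgy, hg⟩
  have hV := values_comp f φ fun y => (hsim y).imp fun g hg =>
    ⟨hg.1, fun _ => mul_mem_valueSpace_of_mem_simFactors hg.2⟩
  have hW := values_comp f ψ fun y => (hsim y).imp fun g hg =>
    ⟨hg.1, fun _ => mul_mem_valueSpace_of_vishikEquiv h hg.2⟩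
  have hfV : ∀ v, v ∈ valueSpace φ ↔ f v ∈ valueSpace (f ∘ φ) := by
    intro v
    rw [mem_valueSpace, mem_valueSpace, hV,
      f.injective.mem_set_image]
  have hfW : ∀ v, v ∈ valueSpace ψ ↔ f v ∈ valueSpace (f ∘ ψ) := by
    intro v
    rw [mem_valueSpace, mem_valueSpace, hW,
      f.injective.mem_set_image]
  obtain ⟨v, hv⟩ : ∃ v, f v = e := by
    rw [mem_valueSpace, hV] at he
    obtain ⟨v, -, hv⟩ := he
    exact ⟨v, hv⟩
  obtain ⟨w, hw⟩ : ∃ w, f w = z⁻¹ * e := by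
    rw [hzW, Submodule.mem_smul_iff_inv_mul_mem hz, mem_valueSpace, hW] at he
    obtain ⟨w, -, hw⟩ := he
    exact ⟨w, hw⟩
  have hfz : f (v / w) = z := by
    rw [map_div₀, hv, hw]
    field_simp
  have hy : v / w ≠ 0 := by
    intro h0
    rw [h0, map_zero] at hfz
    exact hz hfz.symm
  refine ⟨v / w, hy, isometric_of_values_eq h.1 ?_⟩
  rw [← valueSpace_eq_iff, valueSpace_mul]
  ext t
  rw [Submodule.mem_smul_iff_inv_mul_mem hy, hfV, hfW, hzW, Submodule.mem_smul_iff_inv_mul_mem hz,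
    map_mul, map_inv₀, hfz]

end SquareClosed

/-- Characteristic 2. Let `φ ∼ᵥ ψ` be totally singular quadratic forms
over `F`, and `K/F` a field extension with `K² = G_F(φ)` (image under `F → K`). If the
anisotropic part of `φ_K` is a special quasi-Pfister neighbor over `K` given by a triple
`(π, b, σ)`, `cπ ⊆ ψ_K` for some `c ∈ K×`, and `σ` is a quasi-Pfister form, a
quasi-Pfister neighbor of codimension one, or minimal over `K`, then `φ` and `ψ` are
similar over `F`. -/
theorem stmt_6 {F : Type u} [Field F] [CharP F 2]
    {n m : ℕ} (φ : Fin n → F) (ψ : Fin m → F)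
    (h : QLF.VishikEquiv 2 φ ψ)
    (K : Type u) [Field K] [CharP K 2] (f : F →+* K)
    (hK : (Set.range fun y : K => y ^ 2) = f '' QLF.simFactors 2 φ)
    {k : ℕ} (φa : Fin k → K) (hφa : QLF.IsAnisotropicPart 2 (f ∘ φ) φa)
    {r s : ℕ} (πc : Fin r → K) (hπc : ∀ i, πc i ≠ 0) (b : K) (hb : b ≠ 0)
    (σ : Fin s → K) (hσπ : QLF.Subform 2 σ (QLF.pfister 2 πc))
    (hspn : QLF.Similar 2 φa (Sum.elim (QLF.pfister 2 πc) fun j => b * σ j))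
    (c : K) (hc : c ≠ 0)
    (hcπ : QLF.Subform 2 (fun e => c * QLF.pfister 2 πc e) (f ∘ ψ))
    (hσ : QLF.IsQuasiPfister 2 σ ∨ QLF.IsQPNeighborCodimOne 2 σ ∨ QLF.Minimal 2 σ) :
    QLF.Similar 2 φ ψ := by
  obtain ⟨⟨e, he, he0⟩, z, hz, hzW⟩ :=
    SquareClosed.exists_valueSpace_comp_eq_smul h f hφa hb hσπ hspn hc hcπ hσ
  exact SquareClosed.similar_of_valueSpace_comp_eq_smul h f hK he he0 hz hzW
end
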